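/- Let b > a > 0 and let λ, μ, ν be real numbers with μ + ν + 1 > λ, μ > −1, ν > −1, and such that (λ + ν − μ + 1)/2 is not a nonpositive integer. Then lim_{ε→0+} ∫_0^∞ e^{−εt} t^{−λ} J_μ(at) J_ν(bt) dt = ( a^μ Γ((μ+ν−λ+1)/2) / ( 2^λ b^{μ−λ+1} Γ(μ+1) Γ((λ+ν−μ+1)/2) ) ) · F( (μ+ν−λ+1)/2 , (μ−λ−ν+1)/2 ; μ+1 ; a²/b² ). -/

import Mathlib

open MeasureTheory Real Filter

noncomputable def besselJ (ν t : ℝ) : ℝ :=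
  ∑' r : ℕ, (-1 : ℝ) ^ r * t ^ (ν + 2 * (r : ℝ)) /
    ((2 : ℝ) ^ (ν + 2 * (r : ℝ)) * (Nat.factorial r : ℝ) * Real.Gamma (ν + (r : ℝ) + 1))

noncomputable def besselI (ν t : ℝ) : ℝ :=
  ∑' r : ℕ, t ^ (ν + 2 * (r : ℝ)) /
    ((2 : ℝ) ^ (ν + 2 * (r : ℝ)) * (Nat.factorial r : ℝ) * Real.Gamma (ν + (r : ℝ) + 1))

noncomputable def besselK (ν t : ℝ) : ℝ :=
  Real.pi / (2 * Real.sin (ν * Real.pi)) * (besselI (-ν) t - besselI ν t)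

noncomputable def besselN (ν t : ℝ) : ℝ :=
  (besselJ ν t * Real.cos (ν * Real.pi) - besselJ (-ν) t) / Real.sin (ν * Real.pi)

noncomputable def hyperF (a b c z : ℝ) : ℝ :=
  ∑' m : ℕ, ((ascPochhammer ℝ m).eval a * (ascPochhammer ℝ m).eval b /
    (ascPochhammer ℝ m).eval c) * z ^ m / (Nat.factorial m : ℝ)

open MeasureTheory Real Filter Set Topology

/-- Normalised Bessel series in the variable `x = t ^ 2 / 4`. -/
noncomputable def bf (ν x : ℝ) : ℝ :=
  ∑' r : ℕ, (-x) ^ r / ((Nat.factorial r : ℝ) * Real.Gamma (ν + (r : ℝ) + 1))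

/-- Rising product. -/
noncomputable def rp (K : ℝ) (n : ℕ) : ℝ := ∏ j ∈ Finset.range n, (K + (j : ℝ))

lemma rp_zero (K : ℝ) : rp K 0 = 1 := by simp [rp]

lemma rp_succ (K : ℝ) (n : ℕ) : rp K (n + 1) = rp K n * (K + n) := by
  simp [rp, Finset.prod_range_succ]

lemma rp_succ_left (K : ℝ) (n : ℕ) : rp K (n + 1) = K * rp (K + 1) n := by
  simp only [rp, Finset.prod_range_succ']
  push_cast
  rw [mul_comm]
  congr 1
  · simp
  · refine Finset.prod_congr rfl fun j _ => by ring

lemma rp_pos {K : ℝ} (hK : 0 < K) (n : ℕ) : 0 < rp K n := by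
  unfold rp; positivity

lemma rp_mono {K L : ℝ} (hK : 0 < K) (h : K ≤ L) (n : ℕ) : rp K n ≤ rp L n := by
  unfold rp
  refine Finset.prod_le_prod (fun i _ => by positivity) fun i _ => by linarith

lemma Gamma_rp {K : ℝ} (hK : 0 < K) (n : ℕ) : Real.Gamma (K + n) = Real.Gamma K * rp K n := by
  induction n with
  | zero => simp [rp_zero]
  | succ n ih =>
    rw [rp_succ, ← mul_assoc, ← ih]
    push_cast
    rw [← add_assoc, Real.Gamma_add_one (by positivity)]
    ring

lemma rp_eq_asc (K : ℝ) (n : ℕ) : (ascPochhammer ℝ n).eval K = rp K n := by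
  induction n with
  | zero => simp [rp_zero]
  | succ n ih => rw [ascPochhammer_succ_eval, ih, rp_succ]

lemma inv_Gamma_rec (z : ℝ) : (Real.Gamma z)⁻¹ = z * (Real.Gamma (z + 1))⁻¹ := by
  rcases eq_or_ne z 0 with rfl | hz
  · simp [Real.Gamma_zero]
  · rw [Real.Gamma_add_one hz, mul_inv, ← mul_assoc, mul_inv_cancel₀ hz, one_mul]

lemma inv_Gamma_sub (z : ℝ) (r : ℕ) :
    (Real.Gamma (z - r))⁻¹ = (-1) ^ r * rp (1 - z) r * (Real.Gamma z)⁻¹ := by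
  induction r with
  | zero => simp [rp_zero]
  | succ r ih =>
    rw [inv_Gamma_rec]
    have : z - ((r + 1 : ℕ) : ℝ) + 1 = z - r := by push_cast; ring
    rw [this, ih, rp_succ]
    push_cast
    ring

lemma Gpos {ν : ℝ} (hν : -1 < ν) (r : ℕ) : 0 < Real.Gamma (ν + (r : ℝ) + 1) :=
  Real.Gamma_pos_of_pos (by have : (0:ℝ) ≤ r := r.cast_nonneg; linarith)

lemma summable_pos {ν x : ℝ} (hν : -1 < ν) (hx : 0 < x) :
    Summable fun r : ℕ => x ^ r / ((Nat.factorial r : ℝ) * Real.Gamma (ν + (r : ℝ) + 1)) := by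
  refine summable_of_ratio_test_tendsto_lt_one (l := 0) one_pos ?_ ?_
  · refine Eventually.of_forall fun r => ?_
    have := Gpos hν r
    positivity
  · have h1 : ∀ r : ℕ, ‖x ^ (r + 1) / ((Nat.factorial (r + 1) : ℝ) * Real.Gamma (ν + ((r + 1 : ℕ) : ℝ) + 1))‖ /
        ‖x ^ r / ((Nat.factorial r : ℝ) * Real.Gamma (ν + (r : ℝ) + 1))‖
        = x * ((1 / ((r : ℝ) + 1)) * (ν + r + 1)⁻¹) := by
      intro r
      have hg := Gpos hν r
      have hg' := Gpos hν (r + 1)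
      rw [Real.norm_of_nonneg (by positivity), Real.norm_of_nonneg (by positivity)]
      have h0 : (0:ℝ) < ν + r + 1 := by have : (0:ℝ) ≤ r := r.cast_nonneg; linarith
      have e : ν + ((r + 1 : ℕ) : ℝ) + 1 = (ν + r + 1) + 1 := by push_cast; ring
      rw [e, Real.Gamma_add_one h0.ne', Nat.factorial_succ]
      push_cast
      field_simp
      ring
    simp_rw [h1]
    have h2 : Tendsto (fun r : ℕ => (ν + (r : ℝ) + 1)⁻¹) atTop (𝓝 0) := by
      refine tendsto_inv_atTop_zero.comp ?_
      exact tendsto_atTop_add_const_right _ _ (tendsto_atTop_add_const_left _ _ tendsto_natCast_atTop_atTop)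
    have := (tendsto_one_div_add_atTop_nhds_zero_nat (𝕜 := ℝ)).mul h2
    simpa using this.const_mul x

lemma summable_abs {ν : ℝ} (hν : -1 < ν) (x : ℝ) :
    Summable fun r : ℕ => |x| ^ r / ((Nat.factorial r : ℝ) * Real.Gamma (ν + (r : ℝ) + 1)) := by
  refine Summable.of_nonneg_of_le (fun r => ?_) (fun r => ?_) (summable_pos hν (x := |x| + 1) (by positivity))
  · have := Gpos hν r; positivity
  · have := Gpos hν r
    gcongr
    linarith

lemma summable_bf {ν : ℝ} (hν : -1 < ν) (x : ℝ) :
    Summable fun r : ℕ => (-x) ^ r / ((Nat.factorial r : ℝ) * Real.Gamma (ν + (r : ℝ) + 1)) := by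
  refine Summable.of_norm_bounded (summable_abs hν x) fun r => ?_
  have := Gpos hν r
  rw [norm_div, norm_pow, norm_neg, Real.norm_eq_abs, Real.norm_of_nonneg (by positivity)]

/-- derivative series, reindexed -/
lemma bf_term_succ {ν : ℝ} (x : ℝ) (r : ℕ) :
    (-((r + 1 : ℕ) : ℝ)) * (-x) ^ r / ((Nat.factorial (r + 1) : ℝ) * Real.Gamma (ν + ((r + 1 : ℕ) : ℝ) + 1))
    = -((-x) ^ r / ((Nat.factorial r : ℝ) * Real.Gamma (ν + 1 + (r : ℝ) + 1))) := by
  rw [Nat.factorial_succ]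
  have e : ν + ((r + 1 : ℕ) : ℝ) + 1 = ν + 1 + (r : ℝ) + 1 := by push_cast; ring
  rw [e]
  push_cast
  have : (r : ℝ) + 1 ≠ 0 := by positivity
  have h2 : (Nat.factorial r : ℝ) ≠ 0 := by positivity
  rw [mul_assoc, neg_mul, neg_div, mul_div_mul_left _ _ this]

lemma hasDerivAt_bf {ν : ℝ} (hν : -1 < ν) (x : ℝ) : HasDerivAt (bf ν) (-(bf (ν + 1) x)) x := by
  set R := |x| + 1 with hR
  have hsum : Summable fun r : ℕ => (r : ℝ) * R ^ (r - 1) / ((Nat.factorial r : ℝ) * Real.Gamma (ν + (r : ℝ) + 1)) := by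
    rw [← summable_nat_add_iff 1]
    refine (summable_pos (ν := ν + 1) (by linarith) (x := R) (by positivity)).congr fun r => ?_
    have := bf_term_succ (ν := ν) (-R) r
    simp only [neg_neg] at this
    rw [add_tsub_cancel_right]
    rw [neg_mul, neg_div, neg_inj] at this
    exact this.symm
  have key := hasDerivAt_tsum_of_isPreconnected (𝕜 := ℝ) (F := ℝ) (y₀ := x) (y := x) (t := Metric.ball 0 R)
    (g := fun (r : ℕ) y => (-y) ^ r / ((Nat.factorial r : ℝ) * Real.Gamma (ν + (r : ℝ) + 1)))
    (g' := fun (r : ℕ) y => (-(r : ℝ)) * (-y) ^ (r - 1) / ((Nat.factorial r : ℝ) * Real.Gamma (ν + (r : ℝ) + 1)))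
    hsum Metric.isOpen_ball (convex_ball _ _).isPreconnected ?_ ?_ (by simp [hR]) (summable_bf hν x) (by simp [hR])
  · have e : ∑' r : ℕ, (-(r : ℝ)) * (-x) ^ (r - 1) / ((Nat.factorial r : ℝ) * Real.Gamma (ν + (r : ℝ) + 1))
        = -(bf (ν + 1) x) := by
      have hs : Summable fun r : ℕ => (-(r : ℝ)) * (-x) ^ (r - 1) / ((Nat.factorial r : ℝ) * Real.Gamma (ν + (r : ℝ) + 1)) := by
        rw [← summable_nat_add_iff 1]
        refine (summable_bf (ν := ν + 1) (by linarith) x).neg.congr fun r => ?_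
        rw [add_tsub_cancel_right]
        exact (bf_term_succ x r).symm
      rw [hs.tsum_eq_zero_add, bf, ← tsum_neg]
      simp only [add_tsub_cancel_right, bf_term_succ]
      simp
    rw [e] at key
    exact key
  · intro r y _
    have h1 : HasDerivAt (fun y : ℝ => (-y) ^ r) ((r : ℝ) * (-y) ^ (r - 1) * (-1)) y :=
      ((hasDerivAt_id y).neg).pow r
    refine (h1.div_const _).congr_deriv ?_
    ring
  · intro r y hy
    have := Gpos hν r
    rw [norm_div, norm_mul, norm_pow, norm_neg, norm_neg, Real.norm_of_nonneg (by positivity : (0:ℝ) ≤ r),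
      Real.norm_of_nonneg (by positivity : 0 ≤ (Nat.factorial r : ℝ) * Real.Gamma (ν + (r : ℝ) + 1))]
    have hy' : ‖y‖ ≤ R := by simpa using (mem_ball_zero_iff.1 hy).le
    gcongr

lemma continuous_bf {ν : ℝ} (hν : -1 < ν) : Continuous (bf ν) :=
  continuous_iff_continuousAt.2 fun x => (hasDerivAt_bf hν x).continuousAt

lemma bf_rec {ν : ℝ} (hν : -1 < ν) (x : ℝ) :
    bf ν x = (ν + 1) * bf (ν + 1) x - x * bf (ν + 2) x := by
  have h0 := summable_bf hν x
  have h1 := summable_bf (ν := ν + 1) (by linarith) x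
  have h2 := summable_bf (ν := ν + 2) (by linarith) x
  have e : bf ν x - (ν + 1) * bf (ν + 1) x = - x * bf (ν + 2) x := by
    have h3 := h0.sub (h1.mul_left (ν + 1))
    unfold bf
    rw [← tsum_mul_left, ← tsum_mul_left, ← h0.tsum_sub (h1.mul_left _), h3.tsum_eq_zero_add]
    have hz : (-x) ^ 0 / ((Nat.factorial 0 : ℝ) * Real.Gamma (ν + ((0 : ℕ) : ℝ) + 1)) -
        (ν + 1) * ((-x) ^ 0 / ((Nat.factorial 0 : ℝ) * Real.Gamma (ν + 1 + ((0 : ℕ) : ℝ) + 1))) = 0 := by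
      have : ν + 1 ≠ 0 := by linarith
      have hg : Real.Gamma (ν + 1) ≠ 0 := (Real.Gamma_pos_of_pos (by linarith)).ne'
      simp [Real.Gamma_add_one this]
      field_simp
      ring
    rw [hz, zero_add]
    refine tsum_congr fun r => ?_
    have hg := Gpos hν (r + 1)
    have h0 : (0:ℝ) < ν + r + 2 := by have : (0:ℝ) ≤ r := r.cast_nonneg; linarith
    have e1 : ν + ((r + 1 : ℕ) : ℝ) + 1 = ν + r + 2 := by push_cast; ring
    have e2 : ν + 1 + ((r + 1 : ℕ) : ℝ) + 1 = ν + r + 2 + 1 := by push_cast; ring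
    have e3 : ν + 2 + (r : ℝ) + 1 = ν + r + 2 + 1 := by ring
    rw [e1] at hg
    rw [e1, e2, e3, Real.Gamma_add_one h0.ne', Nat.factorial_succ]
    push_cast
    field_simp
    ring
  linarith

lemma bf_zero {ν : ℝ} : bf ν 0 = 1 / Real.Gamma (ν + 1) := by
  unfold bf
  rw [tsum_eq_single 0]
  · simp
  · intro r hr
    simp [hr]

lemma bf_energy {ν : ℝ} (hν : -1 / 2 ≤ ν) {x : ℝ} (hx : 0 ≤ x) :
    bf ν x ^ 2 + x * bf (ν + 1) x ^ 2 ≤ (1 / Real.Gamma (ν + 1)) ^ 2 := by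
  have hd : ∀ y : ℝ, HasDerivAt (fun y => bf ν y ^ 2 + y * bf (ν + 1) y ^ 2)
      (-(2 * ν + 1) * bf (ν + 1) y ^ 2) y := by
    intro y
    have h1 := (hasDerivAt_bf (ν := ν) (by linarith) y).pow 2
    have h2 := (hasDerivAt_id y).mul ((hasDerivAt_bf (ν := ν + 1) (by linarith) y).pow 2)
    have h3 := bf_rec (ν := ν) (by linarith) y
    refine (h1.add h2).congr_deriv ?_
    have e : ν + 1 + 1 = ν + 2 := by ring
    simp only [e, id_eq, Nat.cast_ofNat, Pi.pow_apply]
    rw [h3]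
    ring
  have anti : AntitoneOn (fun y => bf ν y ^ 2 + y * bf (ν + 1) y ^ 2) (Ici 0) := by
    refine antitoneOn_of_deriv_nonpos (convex_Ici 0) ?_ ?_ ?_
    · exact fun y _ => (hd y).continuousAt.continuousWithinAt
    · exact fun y _ => (hd y).differentiableAt.differentiableWithinAt
    · intro y _
      rw [(hd y).deriv]
      have : 0 ≤ (2 * ν + 1) * bf (ν + 1) y ^ 2 := mul_nonneg (by linarith) (sq_nonneg _)
      linarith
  have := anti (mem_Ici.2 le_rfl) (mem_Ici.2 hx) hx
  simpa [bf_zero] using this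

lemma bf_bdd {ν : ℝ} (hν : -1 / 2 ≤ ν) : ∃ C, 0 ≤ C ∧ ∀ x, 0 ≤ x → |bf ν x| ≤ C := by
  have hg : 0 < Real.Gamma (ν + 1) := Real.Gamma_pos_of_pos (by linarith)
  refine ⟨1 / Real.Gamma (ν + 1), by positivity, fun x hx => ?_⟩
  refine abs_le_of_sq_le_sq ?_ (by positivity)
  have := bf_energy hν hx
  have h2 : 0 ≤ x * bf (ν + 1) x ^ 2 := by positivity
  linarith

lemma bf_growth {ν : ℝ} (hν : -1 < ν) : ∃ C, 0 ≤ C ∧ ∀ x, 0 ≤ x → |bf ν x| ≤ C * (1 + x) := by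
  obtain ⟨C1, h1, hC1⟩ := bf_bdd (ν := ν + 1) (by linarith)
  obtain ⟨C2, h2, hC2⟩ := bf_bdd (ν := ν + 2) (by linarith)
  have h0 : 0 ≤ ν + 1 := by linarith
  refine ⟨(ν + 1) * C1 + C2, by positivity, fun x hx => ?_⟩
  rw [bf_rec hν]
  calc |(ν + 1) * bf (ν + 1) x - x * bf (ν + 2) x| ≤ |(ν + 1) * bf (ν + 1) x| + |x * bf (ν + 2) x| := abs_sub _ _
    _ ≤ (ν + 1) * C1 + x * C2 := by
      rw [abs_mul, abs_mul, abs_of_nonneg h0, abs_of_nonneg hx]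
      gcongr
      · exact hC1 x hx
      · exact hC2 x hx
    _ ≤ _ := by nlinarith [mul_nonneg (mul_nonneg h0 h1) hx]

lemma bf_decay_step {ν : ℝ} (hν : -1 < ν) {C1 C2 x : ℝ} (hx : 0 ≤ x)
    (h1 : |bf ν x| ≤ C1) (h2 : |bf (ν + 1) x| ≤ C2) : x * |bf (ν + 2) x| ≤ C1 + (ν + 1) * C2 := by
  have h := bf_rec hν x
  have e : x * bf (ν + 2) x = (ν + 1) * bf (ν + 1) x - bf ν x := by linarith
  have e' : x * |bf (ν + 2) x| = |x * bf (ν + 2) x| := by rw [abs_mul, abs_of_nonneg hx]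
  rw [e', e]
  calc _ ≤ |(ν + 1) * bf (ν + 1) x| + |bf ν x| := abs_sub _ _
    _ ≤ _ := by
      rw [abs_mul, abs_of_nonneg (by linarith : 0 ≤ ν + 1)]
      have : (ν + 1) * |bf (ν + 1) x| ≤ (ν + 1) * C2 := mul_le_mul_of_nonneg_left h2 (by linarith)
      linarith

lemma bf_decay {ν : ℝ} (hν : 7 / 2 ≤ ν) : ∃ C, 0 ≤ C ∧ ∀ x, 0 ≤ x → |bf ν x| ≤ C / (1 + x ^ 2) := by
  obtain ⟨C0, h0, hC0⟩ := bf_bdd (ν := ν - 4) (by linarith)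
  obtain ⟨C1, h1, hC1⟩ := bf_bdd (ν := ν - 4 + 1) (by linarith)
  obtain ⟨C2, h2, hC2⟩ := bf_bdd (ν := ν - 4 + 1 + 1) (by linarith)
  obtain ⟨C4, h4, hC4⟩ := bf_bdd (ν := ν) (by linarith)
  set D1 := C0 + (ν - 4 + 1) * C1
  set D2 := C1 + (ν - 4 + 1 + 1) * C2
  have hD1 : 0 ≤ D1 := add_nonneg h0 (mul_nonneg (by linarith) h1)
  have hD2 : 0 ≤ D2 := add_nonneg h1 (mul_nonneg (by linarith) h2)
  have hm : 0 ≤ (ν - 1) * D2 := mul_nonneg (by linarith) hD2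
  refine ⟨C4 + (D1 + (ν - 1) * D2), by positivity, fun x hx => ?_⟩
  have k1 := bf_decay_step (by linarith) hx (hC0 x hx) (hC1 x hx)
  have k2 := bf_decay_step (by linarith) hx (hC1 x hx) (hC2 x hx)
  have k3 : x * (x * |bf ν x|) ≤ D1 + (ν - 1) * D2 := by
    have e1 : ν - 4 + 1 + 2 = ν - 4 + 2 + 1 := by ring
    have e2 : ν - 4 + 2 + 2 = ν := by ring
    rw [e1] at k2
    have := bf_decay_step (ν := ν - 4 + 2) (by linarith) hx le_rfl le_rfl
    rw [e2] at this
    have h' := mul_le_mul_of_nonneg_left this hx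
    have e3 : x * (|bf (ν - 4 + 2) x| + (ν - 4 + 2 + 1) * |bf (ν - 4 + 2 + 1) x|) =
      x * |bf (ν - 4 + 2) x| + (ν - 1) * (x * |bf (ν - 4 + 2 + 1) x|) := by ring
    rw [e3] at h'
    have := mul_le_mul_of_nonneg_left k2 (by linarith : 0 ≤ ν - 1)
    linarith
  have k4 := hC4 x hx
  rw [le_div_iff₀ (by positivity)]
  nlinarith

/-- continuous with at most quartic growth -/
def GB (g : ℝ → ℝ) : Prop := Continuous g ∧ ∃ C, 0 ≤ C ∧ ∀ t, 0 ≤ t → |g t| ≤ C * (1 + t ^ 4)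

lemma GB_int {g : ℝ → ℝ} (hg : GB g) {σ c : ℝ} (hσ : 0 < σ) (hc : 0 < c) :
    IntegrableOn (fun t => Real.exp (-c * t) * (t ^ (σ - 1) * g t)) (Ioi 0) := by
  obtain ⟨hcont, C, hC, hb⟩ := hg
  have i1 := integrableOn_rpow_mul_exp_neg_mul_rpow (p := 1) (s := σ - 1) (b := c) (by linarith) one_pos hc
  have i2 := integrableOn_rpow_mul_exp_neg_mul_rpow (p := 1) (s := σ - 1 + 4) (b := c) (by linarith) one_pos hc
  refine Integrable.mono' ((i1.add i2).const_mul C) ?_ ?_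
  · refine ContinuousOn.aestronglyMeasurable ?_ measurableSet_Ioi
    intro t ht
    have ht' : t ≠ 0 := (ne_of_gt ht)
    refine ContinuousAt.continuousWithinAt ?_
    have := hcont.continuousAt (x := t)
    have h2 : ContinuousAt (fun t : ℝ => t ^ (σ - 1)) t := Real.continuousAt_rpow_const _ _ (Or.inl ht')
    fun_prop
  · refine (ae_restrict_iff' measurableSet_Ioi).2 (Eventually.of_forall fun t ht => ?_)
    have ht : 0 < t := ht
    have hp : t ^ (σ - 1 + 4) = t ^ (σ - 1) * t ^ 4 := by
      rw [Real.rpow_add ht]; norm_cast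
    simp only [Pi.add_apply, Real.rpow_one, hp]
    rw [norm_mul, norm_mul, Real.norm_of_nonneg (Real.exp_pos _).le,
      Real.norm_of_nonneg (Real.rpow_nonneg ht.le _), Real.norm_eq_abs]
    calc Real.exp (-c * t) * (t ^ (σ - 1) * |g t|) ≤ Real.exp (-c * t) * (t ^ (σ - 1) * (C * (1 + t ^ 4))) := by
          gcongr; exact hb t ht.le
      _ = _ := by ring

/-- Laplace transform. -/
noncomputable def lap (w : ℝ → ℝ) (p : ℂ) : ℂ := ∫ t in Ioi (0 : ℝ), Complex.exp (-p * t) * (w t : ℂ)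

def LI (w : ℝ → ℝ) : Prop := ∀ c, 0 < c → IntegrableOn (fun t => Real.exp (-c * t) * w t) (Ioi 0)

lemma LI.meas {w : ℝ → ℝ} (hw : LI w) : AEStronglyMeasurable w (volume.restrict (Ioi 0)) := by
  have h := (hw 1 one_pos).aestronglyMeasurable
  have h2 : AEStronglyMeasurable (fun t : ℝ => Real.exp t) (volume.restrict (Ioi 0)) :=
    Real.continuous_exp.aestronglyMeasurable
  refine (h2.mul h).congr (Eventually.of_forall fun t => ?_)
  simp only [Pi.mul_apply]
  rw [← mul_assoc, ← Real.exp_add]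
  simp

lemma LI.measC {w : ℝ → ℝ} (hw : LI w) (p : ℂ) :
    AEStronglyMeasurable (fun t : ℝ => Complex.exp (-p * t) * (w t : ℂ)) (volume.restrict (Ioi 0)) := by
  refine AEStronglyMeasurable.mul ?_ (Complex.continuous_ofReal.comp_aestronglyMeasurable hw.meas)
  exact Continuous.aestronglyMeasurable (by fun_prop)

lemma norm_cexp_mul (p : ℂ) (t x : ℝ) :
    ‖Complex.exp (-p * t) * (x : ℂ)‖ = Real.exp (-p.re * t) * |x| := by
  rw [norm_mul, Complex.norm_exp, Complex.norm_real, Real.norm_eq_abs]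
  simp

lemma LI.abs_int {w : ℝ → ℝ} (hw : LI w) {c : ℝ} (hc : 0 < c) :
    IntegrableOn (fun t => Real.exp (-c * t) * |w t|) (Ioi 0) := by
  refine (hw c hc).abs.congr (Eventually.of_forall fun t => ?_)
  simp [abs_mul]

lemma LI.int {w : ℝ → ℝ} (hw : LI w) {p : ℂ} (hp : 0 < p.re) :
    IntegrableOn (fun t : ℝ => Complex.exp (-p * t) * (w t : ℂ)) (Ioi 0) := by
  refine Integrable.mono' (hw.abs_int hp) (hw.measC p) (Eventually.of_forall fun t => ?_)
  rw [norm_cexp_mul]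

lemma LI.diff {w : ℝ → ℝ} (hw : LI w) {p : ℂ} (hp : 0 < p.re) : DifferentiableAt ℂ (lap w) p := by
  set c := p.re / 2 with hc
  have hc0 : 0 < c := by positivity
  have hs : {z : ℂ | c < z.re} ∈ 𝓝 p := by
    refine (isOpen_lt continuous_const Complex.continuous_re).mem_nhds ?_
    simp only [mem_ofPred_eq]; linarith
  have := hasDerivAt_integral_of_dominated_loc_of_deriv_le (𝕜 := ℂ) (μ := volume.restrict (Ioi (0:ℝ)))
    (F := fun z (t : ℝ) => Complex.exp (-z * t) * (w t : ℂ))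
    (F' := fun z (t : ℝ) => (-(t : ℂ)) * (Complex.exp (-z * t) * (w t : ℂ)))
    (bound := fun t => (2 / c) * (Real.exp (-(c / 2) * t) * |w t|)) (x₀ := p)
    hs (Eventually.of_forall fun z => hw.measC z) (hw.int hp) ?_ ?_ ?_ ?_
  · exact this.2.differentiableAt
  · refine AEStronglyMeasurable.mul ?_ (hw.measC p)
    exact Continuous.aestronglyMeasurable (by fun_prop)
  · refine (ae_restrict_iff' measurableSet_Ioi).2 (Eventually.of_forall fun t ht z hz => ?_)
    have ht : 0 < t := ht
    have hz : c < z.re := hz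
    rw [norm_mul, norm_cexp_mul, norm_neg, Complex.norm_real, Real.norm_of_nonneg ht.le]
    have h1 : Real.exp (-z.re * t) ≤ Real.exp (-(c / 2) * t) * Real.exp (-(c / 2) * t) := by
      rw [← Real.exp_add]
      apply Real.exp_le_exp.2
      nlinarith
    have h2 : t * Real.exp (-(c / 2) * t) ≤ 2 / c := by
      have := Real.add_one_le_exp (c / 2 * t)
      rw [neg_mul, Real.exp_neg, ← div_eq_mul_inv, div_le_div_iff₀ (Real.exp_pos _) hc0]
      nlinarith
    calc t * (Real.exp (-z.re * t) * |w t|)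
        ≤ t * ((Real.exp (-(c / 2) * t) * Real.exp (-(c / 2) * t)) * |w t|) := by gcongr
      _ = (t * Real.exp (-(c / 2) * t)) * (Real.exp (-(c / 2) * t) * |w t|) := by ring
      _ ≤ _ := by gcongr
  · exact (hw.abs_int (by positivity)).const_mul _
  · refine Eventually.of_forall fun t z _ => ?_
    have h1 : HasDerivAt (fun z : ℂ => -z * (t : ℂ)) (-1 * (t : ℂ)) z := (hasDerivAt_id z).neg.mul_const _
    refine ((h1.cexp).mul_const _).congr_deriv ?_
    ring

lemma lap_congr {v w : ℝ → ℝ} (h : ∀ t, 0 < t → v t = w t) (p : ℂ) : lap v p = lap w p := by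
  unfold lap
  refine setIntegral_congr_fun measurableSet_Ioi fun t ht => ?_
  simp only [h t ht]

lemma lap_const_mul (k : ℝ) (w : ℝ → ℝ) (p : ℂ) : lap (fun t => k * w t) p = k * lap w p := by
  unfold lap
  rw [← integral_const_mul]
  congr 1; ext t; push_cast; ring

lemma lap_add {v w : ℝ → ℝ} (hv : LI v) (hw : LI w) {p : ℂ} (hp : 0 < p.re) :
    lap (fun t => v t + w t) p = lap v p + lap w p := by
  unfold lap
  rw [← integral_add (hv.int hp) (hw.int hp)]
  congr 1; ext t; push_cast; ring

lemma LI.const_mul {w : ℝ → ℝ} (hw : LI w) (k : ℝ) : LI (fun t => k * w t) := fun c hc =>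
  ((hw c hc).const_mul k).congr (Eventually.of_forall fun t => by simp only []; ring)

lemma GB.li {g : ℝ → ℝ} (hg : GB g) {σ : ℝ} (hσ : 0 < σ) : LI (fun t => t ^ (σ - 1) * g t) :=
  fun _ hc => GB_int hg hσ hc

lemma lap_ibp {g g' : ℝ → ℝ} (hg : GB g) (hg' : GB g') (hd : ∀ t, HasDerivAt g (g' t) t)
    {σ : ℝ} (hσ : 0 < σ) {p : ℂ} (hp : 0 < p.re) :
    p * lap (fun t => t ^ σ * g t) p =
      σ * lap (fun t => t ^ (σ - 1) * g t) p + lap (fun t => t ^ σ * g' t) p := by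
  have eσ : σ = (σ + 1) - 1 := by ring
  have L1 : LI (fun t => t ^ σ * g t) := by
    have := hg.li (σ := σ + 1) (by linarith)
    rwa [← eσ] at this
  have L2 : LI (fun t => t ^ σ * g' t) := by
    have := hg'.li (σ := σ + 1) (by linarith)
    rwa [← eσ] at this
  have L3 : LI (fun t => t ^ (σ - 1) * g t) := hg.li hσ
  have L4 : LI (fun t => σ * (t ^ (σ - 1) * g t)) := L3.const_mul σ
  set F : ℝ → ℂ := fun t => Complex.exp (-p * t) * ((t ^ σ * g t : ℝ) : ℂ) with hF
  set F' : ℝ → ℂ := fun t => (-p) * (Complex.exp (-p * t) * ((t ^ σ * g t : ℝ) : ℂ)) +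
    (Complex.exp (-p * t) * ((σ * (t ^ (σ - 1) * g t) : ℝ) : ℂ) +
      Complex.exp (-p * t) * ((t ^ σ * g' t : ℝ) : ℂ)) with hF'
  have hderiv : ∀ t ∈ Ioi (0:ℝ), HasDerivAt F (F' t) t := by
    intro t ht
    have ht' : t ≠ 0 := ne_of_gt ht
    have h1 : HasDerivAt (fun t : ℝ => Complex.exp (-p * t)) (Complex.exp (-p * t) * (-p * 1)) t := by
      have h0 : HasDerivAt (fun t : ℝ => -p * (t : ℂ)) (-p * 1) t :=
        ((hasDerivAt_id t).ofReal_comp).const_mul (-p)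
      exact h0.cexp
    have h2 := ((Real.hasDerivAt_rpow_const (p := σ) (Or.inl ht')).mul (hd t)).ofReal_comp
    refine (h1.mul h2).congr_deriv ?_
    simp only [hF', Pi.mul_apply]
    push_cast
    ring
  have iF : IntegrableOn F (Ioi 0) := L1.int hp
  have iF' : IntegrableOn F' (Ioi 0) :=
    Integrable.add ((L1.int hp).const_mul (-p)) (Integrable.add (L4.int hp) (L2.int hp))
  have hlim := tendsto_zero_of_hasDerivAt_of_integrableOn_Ioi hderiv iF' iF
  have hcont : ContinuousWithinAt F (Ici 0) 0 := by
    refine ContinuousAt.continuousWithinAt ?_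
    have h2 : ContinuousAt (fun t : ℝ => t ^ σ) 0 := Real.continuousAt_rpow_const _ _ (Or.inr hσ.le)
    have h3 := hg.1.continuousAt (x := 0)
    exact ContinuousAt.mul (Continuous.continuousAt (by fun_prop))
      (Complex.continuous_ofReal.continuousAt.comp (h2.mul h3))
  have key := integral_Ioi_of_hasDerivAt_of_tendsto hcont hderiv iF' hlim
  have hF0 : F 0 = 0 := by simp [hF, Real.zero_rpow hσ.ne']
  have e : ∫ t in Ioi (0:ℝ), F' t = (-p) * lap (fun t => t ^ σ * g t) p +
      (lap (fun t => σ * (t ^ (σ - 1) * g t)) p + lap (fun t => t ^ σ * g' t) p) := by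
    unfold lap
    rw [← integral_const_mul, ← integral_add (L4.int hp) (L2.int hp), ← integral_add ((L1.int hp).const_mul (-p))]
    exact (L4.int hp).add (L2.int hp)
  rw [e, lap_const_mul, hF0] at key
  linear_combination -key

noncomputable def LA (β ν σ : ℝ) (p : ℂ) : ℂ := lap (fun t => t ^ (σ - 1) * bf ν (β ^ 2 * t ^ 2)) p

lemma one_add_le (β t : ℝ) : 1 + β ^ 2 * t ^ 2 ≤ (1 + β ^ 2) * (1 + t ^ 2) := by nlinarith [sq_nonneg β, sq_nonneg t]

lemma bf_growth' {ν : ℝ} (hν : -1 < ν) (β : ℝ) :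
    ∃ C, 0 ≤ C ∧ ∀ t, |bf ν (β ^ 2 * t ^ 2)| ≤ C * (1 + t ^ 2) := by
  obtain ⟨C, hC, h⟩ := bf_growth hν
  refine ⟨C * (1 + β ^ 2), by positivity, fun t => ?_⟩
  calc _ ≤ C * (1 + β ^ 2 * t ^ 2) := h _ (by positivity)
    _ ≤ C * ((1 + β ^ 2) * (1 + t ^ 2)) := by gcongr; exact one_add_le β t
    _ = _ := by ring

lemma continuous_bf' {ν : ℝ} (hν : -1 < ν) (β : ℝ) : Continuous fun t : ℝ => bf ν (β ^ 2 * t ^ 2) :=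
  (continuous_bf hν).comp (by fun_prop)

lemma GB_bf {ν : ℝ} (hν : -1 < ν) (β : ℝ) : GB fun t => bf ν (β ^ 2 * t ^ 2) := by
  obtain ⟨C, hC, h⟩ := bf_growth' hν β
  refine ⟨continuous_bf' hν β, C * 2, by positivity, fun t ht => ?_⟩
  have : (1 + t ^ 2) ≤ 2 * (1 + t ^ 4) := by nlinarith [sq_nonneg (t ^ 2 - 1)]
  calc _ ≤ C * (1 + t ^ 2) := h t
    _ ≤ C * (2 * (1 + t ^ 4)) := by gcongr
    _ = _ := by ring

lemma GB_bf_bf {μ ν : ℝ} (hμ : -1 < μ) (hν : -1 < ν) (α β : ℝ) :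
    GB fun t => bf μ (α ^ 2 * t ^ 2) * bf ν (β ^ 2 * t ^ 2) := by
  obtain ⟨C, hC, h⟩ := bf_growth' hμ α
  obtain ⟨D, hD, h'⟩ := bf_growth' hν β
  refine ⟨(continuous_bf' hμ α).mul (continuous_bf' hν β), C * D * 2, by positivity, fun t ht => ?_⟩
  have : (1 + t ^ 2) ^ 2 ≤ 2 * (1 + t ^ 4) := by nlinarith [sq_nonneg (t ^ 2 - 1)]
  rw [abs_mul]
  calc _ ≤ (C * (1 + t ^ 2)) * (D * (1 + t ^ 2)) := by
        gcongr
        · exact h t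
        · exact h' t
    _ = C * D * (1 + t ^ 2) ^ 2 := by ring
    _ ≤ C * D * (2 * (1 + t ^ 4)) := by gcongr
    _ = _ := by ring

lemma GB_t_bf {ν : ℝ} (hν : -1 < ν) (β k : ℝ) : GB fun t => k * t * bf ν (β ^ 2 * t ^ 2) := by
  obtain ⟨C, hC, h⟩ := bf_growth' hν β
  refine ⟨by have := continuous_bf' hν β; fun_prop, |k| * C * 4, by positivity, fun t ht => ?_⟩
  have : t * (1 + t ^ 2) ≤ 4 * (1 + t ^ 4) := by
    nlinarith [sq_nonneg (t ^ 2 - 1), sq_nonneg (t - 1), sq_nonneg (t ^ 2 - t)]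
  rw [abs_mul, abs_mul, abs_of_nonneg ht]
  calc _ ≤ |k| * t * (C * (1 + t ^ 2)) := by gcongr; exact h t
    _ = |k| * C * (t * (1 + t ^ 2)) := by ring
    _ ≤ |k| * C * (4 * (1 + t ^ 4)) := by gcongr
    _ = _ := by ring

lemma LI_bf {ν : ℝ} (hν : -1 < ν) (β : ℝ) {σ : ℝ} (hσ : 0 < σ) :
    LI (fun t => t ^ (σ - 1) * bf ν (β ^ 2 * t ^ 2)) := (GB_bf hν β).li hσ

lemma hasDerivAt_bf' {ν : ℝ} (hν : -1 < ν) (β t : ℝ) :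
    HasDerivAt (fun t => bf ν (β ^ 2 * t ^ 2)) ((-2 * β ^ 2) * t * bf (ν + 1) (β ^ 2 * t ^ 2)) t := by
  have h1 : HasDerivAt (fun t : ℝ => β ^ 2 * t ^ 2) (β ^ 2 * (2 * t)) t := by
    have := (hasDerivAt_pow 2 t).const_mul (β ^ 2)
    simpa using this
  refine ((hasDerivAt_bf hν (β ^ 2 * t ^ 2)).comp t h1).congr_deriv ?_
  ring

lemma LA_rec1 {ν : ℝ} (hν : -1 < ν) (β : ℝ) {σ : ℝ} (hσ : 0 < σ) {p : ℂ} (hp : 0 < p.re) :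
    p * LA β ν (σ + 1) p = σ * LA β ν σ p - 2 * β ^ 2 * LA β (ν + 1) (σ + 2) p := by
  have h := lap_ibp (GB_bf hν β) (GB_t_bf (ν := ν + 1) (by linarith) β (-2 * β ^ 2)) (hasDerivAt_bf' hν β) hσ hp
  have e : lap (fun t => t ^ σ * ((-2 * β ^ 2) * t * bf (ν + 1) (β ^ 2 * t ^ 2))) p =
      -2 * β ^ 2 * LA β (ν + 1) (σ + 2) p := by
    have h2 := lap_const_mul (-2 * β ^ 2) (fun t => t ^ (σ + 2 - 1) * bf (ν + 1) (β ^ 2 * t ^ 2)) p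
    push_cast at h2
    rw [LA, ← h2]
    refine lap_congr (fun t ht => ?_) p
    rw [show σ + 2 - 1 = σ + 1 by ring, Real.rpow_add_one ht.ne']
    ring
  rw [e] at h
  have e2 : LA β ν (σ + 1) p = lap (fun t => t ^ σ * bf ν (β ^ 2 * t ^ 2)) p := by
    rw [LA, show σ + 1 - 1 = σ by ring]
  have e3 : lap (fun t => t ^ (σ - 1) * bf ν (β ^ 2 * t ^ 2)) p = LA β ν σ p := rfl
  rw [e2, h, e3]
  ring

lemma LA_rec2 {ν : ℝ} (hν : -1 < ν) (β : ℝ) {σ : ℝ} (hσ : 0 < σ) {p : ℂ} (hp : 0 < p.re) :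
    p * LA β (ν + 1) (σ + 2) p = (σ - 1 - 2 * ν) * LA β (ν + 1) (σ + 1) p + 2 * LA β ν (σ + 1) p := by
  have h := lap_ibp (GB_bf (ν := ν + 1) (by linarith) β)
    (GB_t_bf (ν := ν + 1 + 1) (by linarith) β (-2 * β ^ 2)) (hasDerivAt_bf' (by linarith) β)
    (σ := σ + 1) (by linarith) hp
  have e : lap (fun t => t ^ (σ + 1) * ((-2 * β ^ 2) * t * bf (ν + 1 + 1) (β ^ 2 * t ^ 2))) p =
      2 * LA β ν (σ + 1) p + (-2 * (ν + 1)) * LA β (ν + 1) (σ + 1) p := by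
    have i1 := (LI_bf hν β (σ := σ + 1) (by linarith)).const_mul 2
    have i2 := (LI_bf (ν := ν + 1) (by linarith) β (σ := σ + 1) (by linarith)).const_mul (-2 * (ν + 1))
    have h2 := lap_add i1 i2 hp
    rw [lap_const_mul, lap_const_mul] at h2
    push_cast at h2
    rw [LA, LA, ← h2]
    refine lap_congr (fun t ht => ?_) p
    rw [show σ + 1 - 1 = σ by ring, Real.rpow_add_one ht.ne', bf_rec hν, show ν + 1 + 1 = ν + 2 by ring]
    ring
  rw [e] at h
  have e2 : LA β (ν + 1) (σ + 2) p = lap (fun t => t ^ (σ + 1) * bf (ν + 1) (β ^ 2 * t ^ 2)) p := by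
    rw [LA, show σ + 2 - 1 = σ + 1 by ring]
  have e3 : lap (fun t => t ^ (σ + 1 - 1) * bf (ν + 1) (β ^ 2 * t ^ 2)) p = LA β (ν + 1) (σ + 1) p := rfl
  rw [e2, h, e3]
  push_cast
  ring

lemma LA_raise {ν : ℝ} (hν : -1 < ν) (β : ℝ) {σ : ℝ} (hσ : 0 < σ) {p : ℂ} (hp : 0 < p.re) :
    LA β ν σ p = (ν + 1) * LA β (ν + 1) σ p - β ^ 2 * LA β (ν + 2) (σ + 2) p := by
  have i1 := (LI_bf (ν := ν + 1) (by linarith) β hσ).const_mul (ν + 1)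
  have i2 := (LI_bf (ν := ν + 2) (by linarith) β (σ := σ + 2) (by linarith)).const_mul (-β ^ 2)
  have h2 := lap_add i1 i2 hp
  rw [lap_const_mul, lap_const_mul] at h2
  push_cast at h2
  have e : LA β ν σ p = (ν + 1) * LA β (ν + 1) σ p + (-β ^ 2) * LA β (ν + 2) (σ + 2) p := by
    rw [LA, LA, LA, ← h2]
    refine lap_congr (fun t ht => ?_) p
    rw [show σ + 2 - 1 = σ - 1 + (2:ℕ) by push_cast; ring, Real.rpow_add_natCast ht.ne', bf_rec hν]
    ring
  rw [e]; ring

lemma isBigO_bf_top {ν : ℝ} (hν : 7 / 2 ≤ ν) : (bf ν) =O[atTop] (fun x : ℝ => x ^ (-(2:ℝ))) := by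
  obtain ⟨C, hC, h⟩ := bf_decay hν
  refine Asymptotics.IsBigO.of_bound C ?_
  filter_upwards [eventually_gt_atTop 0] with x hx
  rw [Real.norm_eq_abs, Real.norm_of_nonneg (by positivity)]
  refine (h x hx.le).trans ?_
  rw [Real.rpow_neg hx.le, div_eq_mul_inv]
  gcongr
  norm_cast
  linarith

lemma isBigO_zero {g : ℝ → ℝ} (hg : Continuous g) : g =O[𝓝[>] 0] (fun x : ℝ => x ^ (-(0:ℝ))) := by
  have : g =O[𝓝 0] (fun _ : ℝ => (1 : ℝ)) := (hg.continuousAt (x := 0)).isBigO_one ℝ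
  simpa using this.mono nhdsWithin_le_nhds

lemma int_bf {ν : ℝ} (hν : 7 / 2 ≤ ν) {z : ℝ} (hz : 0 < z) (hz2 : z < 2) :
    IntegrableOn (fun x => x ^ (z - 1) * bf ν x) (Ioi 0) :=
  mellin_convergent_of_isBigO_scalar ((continuous_bf (by linarith)).locallyIntegrable.locallyIntegrableOn _)
    (isBigO_bf_top hν) hz2 (isBigO_zero (continuous_bf (by linarith))) hz

lemma int_bf' {ν : ℝ} (hν : 7 / 2 ≤ ν) {β : ℝ} (hβ : 0 < β) {σ : ℝ} (hσ : 0 < σ) (hσ2 : σ < 4) :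
    IntegrableOn (fun t => t ^ (σ - 1) * bf ν (β ^ 2 * t ^ 2)) (Ioi 0) := by
  have hc := continuous_bf' (ν := ν) (by linarith) β
  refine mellin_convergent_of_isBigO_scalar (hc.locallyIntegrable.locallyIntegrableOn _)
    (a := 4) ?_ hσ2 (isBigO_zero hc) hσ
  obtain ⟨C, hC, h⟩ := bf_decay hν
  refine Asymptotics.IsBigO.of_bound (C / β ^ 4) ?_
  filter_upwards [eventually_gt_atTop 0] with x hx
  rw [Real.norm_eq_abs, Real.norm_of_nonneg (by positivity)]
  refine (h _ (by positivity)).trans ?_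
  rw [Real.rpow_neg hx.le, ← div_eq_mul_inv, div_div]
  gcongr
  norm_cast
  nlinarith

lemma weber {ν : ℝ} (hν : -1 < ν) {y : ℝ} (hy : 0 < y) :
    ∫ x in Ioi (0:ℝ), x ^ ν * Real.exp (-(y * x)) * bf ν x = (1 / y) ^ (ν + 1) * Real.exp (-(1 / y)) := by
  set c : ℕ → ℝ := fun r => 1 / ((Nat.factorial r : ℝ) * Real.Gamma (ν + (r : ℝ) + 1)) with hc
  have hcpos : ∀ r, 0 < c r := fun r => by have := Gpos hν r; simp only [hc]; positivity
  have hpos : ∀ r : ℕ, 0 < ν + (r : ℝ) + 1 := fun r => by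
    have : (0:ℝ) ≤ r := r.cast_nonneg
    linarith
  set F : ℕ → ℝ → ℝ := fun r x => ((-1) ^ r * c r) * (x ^ (ν + (r : ℝ) + 1 - 1) * Real.exp (-(y * x))) with hF
  have hintg : ∀ r : ℕ, IntegrableOn (fun x => x ^ (ν + (r : ℝ) + 1 - 1) * Real.exp (-(y * x))) (Ioi 0) := by
    intro r
    have := integrableOn_rpow_mul_exp_neg_mul_rpow (p := 1) (s := ν + (r : ℝ) + 1 - 1) (b := y)
      (by linarith [hpos r]) one_pos hy
    simpa using this
  have hval : ∀ r : ℕ, ∫ x in Ioi (0:ℝ), F r x = (1 / y) ^ (ν + 1) * ((-(1 / y)) ^ r / (Nat.factorial r : ℝ)) := by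
    intro r
    simp only [hF]
    rw [integral_const_mul, Real.integral_rpow_mul_exp_neg_mul_Ioi (hpos r) hy,
      show ν + (r : ℝ) + 1 = (ν + 1) + r by ring, Real.rpow_add_natCast (by positivity)]
    have := Gpos hν r
    rw [show ν + (r : ℝ) + 1 = (ν + 1) + r by ring] at this
    simp only [hc]
    rw [show ν + (r : ℝ) + 1 = (ν + 1) + r by ring, neg_pow (1 / y) r]
    field_simp
  have hnorm : ∀ r : ℕ, ∫ x in Ioi (0:ℝ), ‖F r x‖ = (1 / y) ^ (ν + 1) * ((1 / y) ^ r / (Nat.factorial r : ℝ)) := by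
    intro r
    have e : ∫ x in Ioi (0:ℝ), ‖F r x‖ = ∫ x in Ioi (0:ℝ), c r * (x ^ (ν + (r : ℝ) + 1 - 1) * Real.exp (-(y * x))) := by
      refine setIntegral_congr_fun measurableSet_Ioi fun x hx => ?_
      have hx : 0 < x := hx
      have := hcpos r
      simp only [hF]
      rw [norm_mul, norm_mul, norm_pow, norm_neg, norm_one, one_pow, one_mul,
        Real.norm_of_nonneg this.le, Real.norm_of_nonneg (by positivity)]
    rw [e, integral_const_mul, Real.integral_rpow_mul_exp_neg_mul_Ioi (hpos r) hy,
      show ν + (r : ℝ) + 1 = (ν + 1) + r by ring, Real.rpow_add_natCast (by positivity)]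
    have := Gpos hν r
    rw [show ν + (r : ℝ) + 1 = (ν + 1) + r by ring] at this
    simp only [hc]
    rw [show ν + (r : ℝ) + 1 = (ν + 1) + r by ring]
    field_simp
  have key := hasSum_integral_of_summable_integral_norm (μ := volume.restrict (Ioi (0:ℝ))) (F := F)
    (fun r => (hintg r).const_mul _) (by
      simp_rw [hnorm]
      exact (Real.summable_pow_div_factorial (1 / y)).mul_left _)
  simp_rw [hval] at key
  have hexp : HasSum (fun r : ℕ => (1 / y) ^ (ν + 1) * ((-(1 / y)) ^ r / (Nat.factorial r : ℝ)))
      ((1 / y) ^ (ν + 1) * Real.exp (-(1 / y))) := by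
    rw [Real.exp_eq_exp_ℝ]
    exact (NormedSpace.expSeries_div_hasSum_exp (-(1 / y))).mul_left _
  rw [← key.unique hexp]
  refine setIntegral_congr_fun measurableSet_Ioi fun x hx => ?_
  have hx : 0 < x := hx
  simp only [bf, hF]
  rw [← tsum_mul_left]
  refine tsum_congr fun r => ?_
  rw [show ν + (r : ℝ) + 1 - 1 = ν + r by ring, Real.rpow_add_natCast hx.ne', neg_pow x r]
  simp only [hc]
  ring

lemma mellin_bf {ν : ℝ} (hν : 7 / 2 ≤ ν) {z : ℝ} (hz : 0 < z) (hz2 : z < 2) :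
    ∫ x in Ioi (0:ℝ), x ^ (z - 1) * bf ν x = Real.Gamma z * (Real.Gamma (ν + 1 - z))⁻¹ := by
  set w := ν + 1 - z with hw
  have hw0 : 0 < w := by linarith
  have hG : 0 < Real.Gamma w := Real.Gamma_pos_of_pos hw0
  set h : ℝ → ℝ → ℝ := fun x y => (y ^ (w - 1) * Real.exp (-(x * y))) * (x ^ ν * bf ν x) with hh
  have hy : ∀ x, 0 < x → ∀ k : ℝ, ∫ y in Ioi (0:ℝ), (y ^ (w - 1) * Real.exp (-(x * y))) * (x ^ ν * k)
      = Real.Gamma w * (x ^ (z - 1) * k) := by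
    intro x hx k
    rw [integral_mul_const, Real.integral_rpow_mul_exp_neg_mul_Ioi hw0 hx]
    have : (1 / x) ^ w * x ^ ν = x ^ (z - 1) := by
      rw [one_div, Real.inv_rpow hx.le, ← Real.rpow_neg hx.le, ← Real.rpow_add hx]
      congr 1
      rw [hw]; ring
    rw [← this]; ring
  have hintg : Integrable (Function.uncurry h) ((volume.restrict (Ioi (0:ℝ))).prod (volume.restrict (Ioi (0:ℝ)))) := by
    rw [integrable_prod_iff]
    · constructor
      · refine (ae_restrict_iff' measurableSet_Ioi).2 (Eventually.of_forall fun x hx => ?_)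
        have := integrableOn_rpow_mul_exp_neg_mul_rpow (p := 1) (s := w - 1) (b := x)
          (by linarith) one_pos hx
        simp only [Real.rpow_one, neg_mul] at this
        exact this.mul_const (x ^ ν * bf ν x)
      · refine ((int_bf hν hz hz2).abs.const_mul (Real.Gamma w)).congr ?_
        refine (ae_restrict_iff' measurableSet_Ioi).2 (Eventually.of_forall fun x hx => ?_)
        have hx : 0 < x := hx
        simp only [hh, Function.uncurry]
        rw [abs_mul, abs_of_nonneg (by positivity : 0 ≤ x ^ (z - 1)), ← hy x hx |bf ν x|]
        refine setIntegral_congr_fun measurableSet_Ioi fun y hy => ?_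
        have hy : 0 < y := hy
        rw [norm_mul, norm_mul (x ^ ν), Real.norm_of_nonneg (by positivity : 0 ≤ x ^ ν), Real.norm_eq_abs (bf ν x),
          Real.norm_of_nonneg (by positivity)]
    · have h1 := (continuous_bf (ν := ν) (by linarith)).measurable
      refine Measurable.aestronglyMeasurable ?_
      simp only [hh, Function.uncurry_def]
      fun_prop
  have sw := integral_integral_swap hintg
  have e1 : ∫ x in Ioi (0:ℝ), ∫ y in Ioi (0:ℝ), h x y = Real.Gamma w * ∫ x in Ioi (0:ℝ), x ^ (z - 1) * bf ν x := by
    rw [← integral_const_mul]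
    exact setIntegral_congr_fun measurableSet_Ioi fun x hx => hy x hx _
  have e2 : ∫ y in Ioi (0:ℝ), ∫ x in Ioi (0:ℝ), h x y = Real.Gamma z := by
    rw [Real.Gamma_eq_integral hz, ← integral_comp_rpow_Ioi (fun x => Real.exp (-x) * x ^ (z - 1)) (p := -1) (by norm_num)]
    refine setIntegral_congr_fun measurableSet_Ioi fun y hy => ?_
    have hy : 0 < y := hy
    have e3 : ∫ x in Ioi (0:ℝ), h x y = y ^ (w - 1) * ∫ x in Ioi (0:ℝ), x ^ ν * Real.exp (-(y * x)) * bf ν x := by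
      rw [← integral_const_mul]
      congr 1; ext x
      simp only [hh]
      rw [mul_comm x y]; ring
    simp only [e3, smul_eq_mul]
    rw [weber (by linarith) hy, one_div, ← Real.rpow_neg_one, ← Real.rpow_mul hy.le, ← Real.rpow_mul hy.le]
    have : y ^ (w - 1) * y ^ (-1 * (ν + 1)) = y ^ (-1 - 1 : ℝ) * y ^ (-1 * (z - 1)) := by
      rw [← Real.rpow_add hy, ← Real.rpow_add hy]
      congr 1
      rw [hw]; ring
    rw [← mul_assoc, this]
    norm_num
    ring
  rw [e1, e2] at sw
  rw [← sw]
  field_simp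

noncomputable def LL (β ν σ : ℝ) : ℝ := β ^ (-σ) * Real.Gamma (σ / 2) / 2 * (Real.Gamma (ν + 1 - σ / 2))⁻¹

lemma mellin_bf' {ν : ℝ} (hν : 7 / 2 ≤ ν) {β : ℝ} (hβ : 0 < β) {σ : ℝ} (hσ : 0 < σ) (hσ2 : σ < 4) :
    ∫ t in Ioi (0:ℝ), t ^ (σ - 1) * bf ν (β ^ 2 * t ^ 2) = LL β ν σ := by
  have h1 := mellin_bf hν (z := σ / 2) (by linarith) (by linarith)
  have h2 := integral_comp_mul_left_Ioi (fun x => x ^ (σ / 2 - 1) * bf ν x) 0 (b := β ^ 2) (by positivity)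
  have h3 := integral_comp_rpow_Ioi_of_pos (g := fun x : ℝ => (β ^ 2 * x) ^ (σ / 2 - 1) * bf ν (β ^ 2 * x))
    (p := 2) two_pos
  rw [mul_zero, h1] at h2
  rw [h2] at h3
  have h4 : ∫ x in Ioi (0:ℝ), (2 * x ^ ((2:ℝ) - 1)) • ((β ^ 2 * x ^ (2:ℝ)) ^ (σ / 2 - 1) * bf ν (β ^ 2 * x ^ (2:ℝ)))
      = (2 * β ^ (σ - 2)) * ∫ t in Ioi (0:ℝ), t ^ (σ - 1) * bf ν (β ^ 2 * t ^ 2) := by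
    rw [← integral_const_mul]
    refine setIntegral_congr_fun measurableSet_Ioi fun t ht => ?_
    have ht : 0 < t := ht
    have a1 : (β ^ 2 * t ^ (2:ℝ)) ^ (σ / 2 - 1) = β ^ (σ - 2) * t ^ (σ - 2) := by
      rw [Real.mul_rpow (by positivity) (by positivity), ← Real.rpow_natCast, ← Real.rpow_mul hβ.le,
        ← Real.rpow_mul ht.le]
      congr 2 <;> push_cast <;> ring
    have a2 : t ^ ((2:ℝ) - 1) * t ^ (σ - 2) = t ^ (σ - 1) := by
      rw [← Real.rpow_add ht]; congr 1; ring
    have a3 : t ^ (2:ℝ) = t ^ 2 := by norm_cast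
    simp only [a1, smul_eq_mul]
    rw [a3, ← a2]
    ring
  rw [h4] at h3
  have a4 : β ^ (σ - 2) = β ^ σ / β ^ 2 := by
    rw [Real.rpow_sub hβ]; norm_cast
  have hb : 0 < β ^ σ := by positivity
  rw [a4, smul_eq_mul] at h3
  rw [LL, Real.rpow_neg hβ.le]
  field_simp at h3 ⊢
  linarith

lemma lap_norm_le {w : ℝ → ℝ} (hi : IntegrableOn w (Ioi 0)) {p : ℂ} (hp : 0 < p.re) :
    ‖lap w p‖ ≤ ∫ t in Ioi (0:ℝ), |w t| := by
  refine norm_integral_le_of_norm_le hi.abs ?_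
  refine (ae_restrict_iff' measurableSet_Ioi).2 (Eventually.of_forall fun t ht => ?_)
  have ht : 0 < t := ht
  rw [norm_cexp_mul]
  have : Real.exp (-p.re * t) ≤ 1 := Real.exp_le_one_iff.2 (by nlinarith)
  nlinarith [abs_nonneg (w t)]

lemma lap_tendsto {w : ℝ → ℝ} (hi : IntegrableOn w (Ioi 0)) (hl : LI w) :
    Tendsto (fun ε : ℝ => lap w (ε : ℂ)) (𝓝[>] 0) (𝓝 ((∫ t in Ioi (0:ℝ), w t : ℝ) : ℂ)) := by
  rw [← integral_complex_ofReal]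
  unfold lap
  refine tendsto_integral_filter_of_dominated_convergence (fun t => |w t|)
    (Eventually.of_forall fun ε => hl.measC _) ?_ hi.abs ?_
  · filter_upwards [self_mem_nhdsWithin] with ε hε
    have hε : 0 < ε := hε
    refine (ae_restrict_iff' measurableSet_Ioi).2 (Eventually.of_forall fun t ht => ?_)
    have ht : 0 < t := ht
    rw [norm_cexp_mul]
    have : Real.exp (-(ε : ℂ).re * t) ≤ 1 := Real.exp_le_one_iff.2 (by simp; nlinarith)
    nlinarith [abs_nonneg (w t)]
  · refine Eventually.of_forall fun t => ?_
    have : Continuous fun ε : ℝ => Complex.exp (-(ε : ℂ) * t) * (w t : ℂ) := by fun_prop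
    have h := this.tendsto 0
    simp only [Complex.ofReal_zero, neg_zero, zero_mul, Complex.exp_zero, one_mul] at h
    exact h.mono_left nhdsWithin_le_nhds

def Om (β ρ : ℝ) : Set ℂ :=
  {p | 0 < p.re ∧ ρ ≤ ‖p - 2 * β * Complex.I‖ ∧ ρ ≤ ‖p + 2 * β * Complex.I‖}

noncomputable def UP (β ν σ : ℝ) (p : ℂ) : ℂ := LA β ν σ p + Complex.I * (β * LA β (ν + 1) (σ + 1) p)
noncomputable def UM (β ν σ : ℝ) (p : ℂ) : ℂ := LA β ν σ p - Complex.I * (β * LA β (ν + 1) (σ + 1) p)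
noncomputable def UN (β ν σ : ℝ) (p : ℂ) : ℝ := max ‖UP β ν σ p‖ ‖UM β ν σ p‖

lemma LA_le_UN (β ν σ : ℝ) (p : ℂ) : ‖LA β ν σ p‖ ≤ UN β ν σ p := by
  have e : LA β ν σ p = (UP β ν σ p + UM β ν σ p) / 2 := by unfold UP UM; ring
  rw [e, norm_div]
  have h1 := norm_add_le (UP β ν σ p) (UM β ν σ p)
  have h2 : ‖UP β ν σ p‖ ≤ UN β ν σ p := le_max_left _ _
  have h3 : ‖UM β ν σ p‖ ≤ UN β ν σ p := le_max_right _ _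
  simp only [Complex.norm_ofNat]
  linarith

lemma UN_le (β ν σ : ℝ) (p : ℂ) : UN β ν σ p ≤ ‖LA β ν σ p‖ + |β| * ‖LA β (ν + 1) (σ + 1) p‖ := by
  have e : ‖Complex.I * (β * LA β (ν + 1) (σ + 1) p)‖ = |β| * ‖LA β (ν + 1) (σ + 1) p‖ := by
    rw [norm_mul, norm_mul, Complex.norm_I, one_mul, Complex.norm_real, Real.norm_eq_abs]
  refine max_le ?_ ?_
  · rw [← e]; exact norm_add_le _ _
  · rw [← e]; exact norm_sub_le _ _

lemma UN_step {β ρ ν σ : ℝ} (hν : -1 < ν) (hσ : 0 < σ) (hρ : 0 < ρ) {p : ℂ} (hp : p ∈ Om β ρ) :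
    UN β ν (σ + 1) p ≤ (σ + 2 * |ν + 1 / 2|) / ρ * UN β ν σ p := by
  obtain ⟨hre, hm, hpl⟩ := hp
  have r1 := LA_rec1 hν β hσ hre
  have r2 := LA_rec2 hν β hσ hre
  have e12 : σ + 1 + 1 = σ + 2 := by ring
  have hI := Complex.I_sq
  have k1 : (p - 2 * β * Complex.I) * UP β ν (σ + 1) p =
      ((σ - 1 / 2 - ν : ℝ) : ℂ) * UP β ν σ p + ((ν + 1 / 2 : ℝ) : ℂ) * UM β ν σ p := by
    unfold UP UM
    rw [e12]
    push_cast
    linear_combination r1 + Complex.I * β * r2 - 2 * β ^ 2 * LA β (ν + 1) (σ + 2) p * hI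
  have k2 : (p + 2 * β * Complex.I) * UM β ν (σ + 1) p =
      ((σ - 1 / 2 - ν : ℝ) : ℂ) * UM β ν σ p + ((ν + 1 / 2 : ℝ) : ℂ) * UP β ν σ p := by
    unfold UP UM
    rw [e12]
    push_cast
    linear_combination r1 - Complex.I * β * r2 - 2 * β ^ 2 * LA β (ν + 1) (σ + 2) p * hI
  have h2 : ‖UP β ν σ p‖ ≤ UN β ν σ p := le_max_left _ _
  have h3 : ‖UM β ν σ p‖ ≤ UN β ν σ p := le_max_right _ _
  have h0 : 0 ≤ UN β ν σ p := (norm_nonneg _).trans h2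
  have hcoef : |σ - 1 / 2 - ν| + |ν + 1 / 2| ≤ σ + 2 * |ν + 1 / 2| := by
    have : |σ - 1 / 2 - ν| ≤ |σ| + |ν + 1 / 2| := by
      have e : σ - 1 / 2 - ν = σ - (ν + 1 / 2) := by ring
      rw [e]; exact abs_sub _ _
    rw [abs_of_pos hσ] at this
    linarith
  have gen : ∀ X Y : ℂ, ‖X‖ ≤ UN β ν σ p → ‖Y‖ ≤ UN β ν σ p →
      ‖((σ - 1 / 2 - ν : ℝ) : ℂ) * X + ((ν + 1 / 2 : ℝ) : ℂ) * Y‖ ≤ (σ + 2 * |ν + 1 / 2|) * UN β ν σ p := by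
    intro X Y hX hY
    refine (norm_add_le _ _).trans ?_
    rw [norm_mul, norm_mul, Complex.norm_real, Complex.norm_real, Real.norm_eq_abs, Real.norm_eq_abs]
    calc _ ≤ |σ - 1 / 2 - ν| * UN β ν σ p + |ν + 1 / 2| * UN β ν σ p := by gcongr
      _ = (|σ - 1 / 2 - ν| + |ν + 1 / 2|) * UN β ν σ p := by ring
      _ ≤ _ := by gcongr
  have fin : ∀ q U W : ℂ, ρ ≤ ‖q‖ → q * U = W → ‖W‖ ≤ (σ + 2 * |ν + 1 / 2|) * UN β ν σ p →
      ‖U‖ ≤ (σ + 2 * |ν + 1 / 2|) / ρ * UN β ν σ p := by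
    intro q U W hq hU hW
    rw [div_mul_eq_mul_div, le_div_iff₀ hρ]
    rw [← hU, norm_mul] at hW
    nlinarith [norm_nonneg U]
  exact max_le (fin _ _ _ hm k1 (gen _ _ h2 h3)) (fin _ _ _ hpl k2 (gen _ _ h3 h2))

def SB (β ρ ν σ : ℝ) : Prop := ∃ C K : ℝ, 0 ≤ C ∧ 0 < K ∧
  ∀ (n : ℕ) (p : ℂ), p ∈ Om β ρ → ‖LA β ν (σ + n) p‖ ≤ C * (rp K n / ρ ^ n)

lemma SB_base {β ρ ν σ : ℝ} (hβ : 0 < β) (hρ : 0 < ρ) (hν : 7 / 2 ≤ ν) (hσ : 0 < σ) (hσ1 : σ ≤ 1) :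
    SB β ρ ν σ := by
  have i1 := int_bf' hν hβ hσ (by linarith)
  have i2 := int_bf' (ν := ν + 1) (by linarith) hβ (σ := σ + 1) (by linarith) (by linarith)
  set C := (∫ t in Ioi (0:ℝ), |t ^ (σ - 1) * bf ν (β ^ 2 * t ^ 2)|) +
    |β| * ∫ t in Ioi (0:ℝ), |t ^ (σ + 1 - 1) * bf (ν + 1) (β ^ 2 * t ^ 2)| with hC
  have hC0 : 0 ≤ C := by
    have h1 : 0 ≤ ∫ t in Ioi (0:ℝ), |t ^ (σ - 1) * bf ν (β ^ 2 * t ^ 2)| := integral_nonneg fun _ => abs_nonneg _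
    have h2 : 0 ≤ ∫ t in Ioi (0:ℝ), |t ^ (σ + 1 - 1) * bf (ν + 1) (β ^ 2 * t ^ 2)| :=
      integral_nonneg fun _ => abs_nonneg _
    positivity
  set K := σ + 2 * |ν + 1 / 2| with hK
  have hK0 : 0 < K := by positivity
  refine ⟨C, K, hC0, hK0, fun n p hp => (LA_le_UN _ _ _ _).trans ?_⟩
  induction n with
  | zero =>
    simp only [Nat.cast_zero, add_zero, rp_zero, pow_zero, div_one, mul_one]
    refine (UN_le _ _ _ _).trans ?_
    rw [hC]
    gcongr
    · exact lap_norm_le i1 hp.1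
    · exact lap_norm_le i2 hp.1
  | succ n ih =>
    have hs := UN_step (σ := σ + n) (by linarith : -1 < ν) (by positivity) hρ hp
    push_cast
    rw [← add_assoc]
    refine hs.trans ?_
    calc _ ≤ (σ + n + 2 * |ν + 1 / 2|) / ρ * (C * (rp K n / ρ ^ n)) := by gcongr
      _ = _ := by rw [rp_succ, hK, pow_succ]; field_simp; ring

lemma SB_succ {β ρ ν σ : ℝ} (hρ : 0 < ρ) (h : SB β ρ ν σ) : SB β ρ ν (σ + 1) := by
  obtain ⟨C, K, hC, hK, hb⟩ := h
  refine ⟨C * K / ρ, K + 1, by positivity, by positivity, fun n p hp => ?_⟩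
  have := hb (n + 1) p hp
  push_cast at this
  rw [show σ + 1 + n = σ + (n + 1) by ring]
  refine this.trans (le_of_eq ?_)
  rw [rp_succ_left, pow_succ]
  field_simp

lemma exists_frac {σ : ℝ} (hσ : 0 < σ) : ∃ (σ0 : ℝ) (m : ℕ), 0 < σ0 ∧ σ0 ≤ 1 ∧ σ = σ0 + m := by
  have h1 : 1 ≤ ⌈σ⌉₊ := Nat.one_le_ceil_iff.2 hσ
  have h2 := Nat.le_ceil σ
  have h3 := Nat.ceil_lt_add_one hσ.le
  refine ⟨σ - (⌈σ⌉₊ - 1), ⌈σ⌉₊ - 1, by linarith, by linarith, ?_⟩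
  push_cast [h1]
  ring

lemma SB_large {β ρ ν σ : ℝ} (hβ : 0 < β) (hρ : 0 < ρ) (hν : 7 / 2 ≤ ν) (hσ : 0 < σ) : SB β ρ ν σ := by
  obtain ⟨σ0, m, h0, h1, rfl⟩ := exists_frac hσ
  clear hσ
  induction m with
  | zero => simpa using SB_base hβ hρ hν h0 h1
  | succ m ih =>
    have := SB_succ hρ ih
    push_cast
    rwa [← add_assoc]

lemma SB_raise {β ρ ν σ : ℝ} (hρ : 0 < ρ) (hν : -1 < ν) (hσ : 0 < σ)
    (h1 : SB β ρ (ν + 1) σ) (h2 : SB β ρ (ν + 2) (σ + 2)) : SB β ρ ν σ := by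
  obtain ⟨C1, K1, hC1, hK1, hb1⟩ := h1
  obtain ⟨C2, K2, hC2, hK2, hb2⟩ := h2
  have hν1 : 0 < ν + 1 := by linarith
  refine ⟨(ν + 1) * C1 + β ^ 2 * C2, max K1 K2, by positivity, by positivity, fun n p hp => ?_⟩
  rw [LA_raise hν β (by positivity) hp.1]
  have b1 := hb1 n p hp
  have b2 := hb2 n p hp
  rw [show σ + n + 2 = σ + 2 + n by ring]
  refine (norm_sub_le _ _).trans ?_
  have e1 : ‖(ν : ℂ) + 1‖ = ν + 1 := by
    rw [show (ν : ℂ) + 1 = ((ν + 1 : ℝ) : ℂ) by push_cast; ring, Complex.norm_real, Real.norm_of_nonneg hν1.le]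
  have e2 : ‖(β : ℂ) ^ 2‖ = β ^ 2 := by
    rw [norm_pow, Complex.norm_real, Real.norm_eq_abs, sq_abs]
  rw [norm_mul, norm_mul, e1, e2]
  have m1 := rp_mono hK1 (le_max_left K1 K2) n
  have m2 := rp_mono hK2 (le_max_right K1 K2) n
  calc _ ≤ (ν + 1) * (C1 * (rp K1 n / ρ ^ n)) + β ^ 2 * (C2 * (rp K2 n / ρ ^ n)) := by gcongr
    _ ≤ (ν + 1) * (C1 * (rp (max K1 K2) n / ρ ^ n)) + β ^ 2 * (C2 * (rp (max K1 K2) n / ρ ^ n)) := by gcongr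
    _ = _ := by ring

lemma SB_all {β ρ ν σ : ℝ} (hβ : 0 < β) (hρ : 0 < ρ) (hν : -1 < ν) (hσ : 0 < σ) : SB β ρ ν σ := by
  have key : ∀ k : ℕ, ∀ ν σ : ℝ, -1 < ν → 0 < σ → 7 / 2 - (k : ℝ) ≤ ν → SB β ρ ν σ := by
    intro k
    induction k with
    | zero => intro ν σ _ hσ h; exact SB_large hβ hρ (by simpa using h) hσ
    | succ k ih =>
      intro ν σ hν hσ h
      push_cast at h
      exact SB_raise hρ hν hσ (ih _ _ (by linarith) hσ (by linarith))
        (ih _ _ (by linarith) (by linarith) (by linarith))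
  exact key 5 ν σ hν hσ (by push_cast; linarith)

def TL (β ν σ : ℝ) : Prop :=
  Tendsto (fun ε : ℝ => LA β ν σ (ε : ℂ)) (𝓝[>] 0) (𝓝 ((LL β ν σ : ℝ) : ℂ))

lemma TL_base {β ν σ : ℝ} (hβ : 0 < β) (hν : 7 / 2 ≤ ν) (hσ : 0 < σ) (hσ1 : σ < 4) : TL β ν σ := by
  have := lap_tendsto (int_bf' hν hβ hσ hσ1) (LI_bf (by linarith) β hσ)
  rwa [mellin_bf' hν hβ hσ hσ1] at this

lemma LL_stepA {β ν σ : ℝ} (hβ : 0 < β) :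
    LL β ν (σ + 1) = -(2 * β ^ 2 * ((σ - 1 - 2 * ν) * LL β (ν + 1) (σ + 1))) / (4 * β ^ 2) := by
  unfold LL
  rw [inv_Gamma_rec (ν + 1 - (σ + 1) / 2), show ν + 1 - (σ + 1) / 2 + 1 = ν + 1 + 1 - (σ + 1) / 2 by ring]
  field_simp
  ring

lemma LL_stepB {β ν σ : ℝ} (hβ : 0 < β) (hσ : 0 < σ) :
    LL β (ν + 1) (σ + 2) = (2 * (σ * LL β ν σ)) / (4 * β ^ 2) := by
  unfold LL
  rw [show (σ + 2) / 2 = σ / 2 + 1 by ring, Real.Gamma_add_one (by positivity),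
    show ν + 1 + 1 - (σ / 2 + 1) = ν + 1 - σ / 2 by ring, show -(σ + 2) = -σ - 2 by ring, Real.rpow_sub hβ]
  norm_cast
  field_simp
  ring

lemma TL_step {β ν σ : ℝ} (hβ : 0 < β) (hν : -1 < ν) (hσ : 0 < σ) (hA : TL β ν σ) (hB : TL β (ν + 1) (σ + 1)) :
    TL β ν (σ + 1) ∧ TL β (ν + 1) (σ + 2) := by
  have hid : Tendsto (fun ε : ℝ => (ε : ℂ)) (𝓝[>] 0) (𝓝 0) := by
    have := (Complex.continuous_ofReal.tendsto 0).mono_left (nhdsWithin_le_nhds (s := Ioi (0:ℝ)))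
    simpa using this
  have hden : Tendsto (fun ε : ℝ => (ε : ℂ) ^ 2 + 4 * (β : ℂ) ^ 2) (𝓝[>] 0) (𝓝 (4 * (β : ℂ) ^ 2)) := by
    have := (hid.pow 2).add_const (4 * (β : ℂ) ^ 2)
    simpa using this
  have hb : (β : ℂ) ≠ 0 := by exact_mod_cast hβ.ne'
  have hd0 : (4 : ℂ) * β ^ 2 ≠ 0 := by simp [hb]
  have hne : ∀ ε : ℝ, (ε : ℂ) ^ 2 + 4 * β ^ 2 ≠ 0 := by
    intro ε
    have : ε ^ 2 + 4 * β ^ 2 ≠ 0 := by positivity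
    exact_mod_cast this
  constructor
  · have h := ((hid.mul (hA.const_mul (σ : ℂ))).sub
      ((hB.const_mul (((σ - 1 - 2 * ν : ℝ) : ℂ))).const_mul (2 * (β : ℂ) ^ 2))).div hden hd0
    unfold TL
    rw [LL_stepA hβ]
    push_cast at h ⊢
    rw [zero_mul, zero_sub] at h
    refine h.congr' ?_
    filter_upwards [self_mem_nhdsWithin] with ε hε
    have hre : 0 < (ε : ℂ).re := by simpa using hε
    have r1 := LA_rec1 hν β hσ hre
    have r2 := LA_rec2 hν β hσ hre
    simp only [Pi.div_apply]
    rw [div_eq_iff (hne ε)]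
    linear_combination - (ε : ℂ) * r1 + 2 * (β : ℂ) ^ 2 * r2
  · have h := (((hA.const_mul (σ : ℂ)).const_mul 2).add
      (hid.mul (hB.const_mul (((σ - 1 - 2 * ν : ℝ) : ℂ))))).div hden hd0
    unfold TL
    rw [LL_stepB hβ hσ]
    push_cast at h ⊢
    rw [zero_mul, add_zero] at h
    refine h.congr' ?_
    filter_upwards [self_mem_nhdsWithin] with ε hε
    have hre : 0 < (ε : ℂ).re := by simpa using hε
    have r1 := LA_rec1 hν β hσ hre
    have r2 := LA_rec2 hν β hσ hre
    simp only [Pi.div_apply]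
    rw [div_eq_iff (hne ε)]
    linear_combination - 2 * r1 - (ε : ℂ) * r2

lemma TL_large {β ν σ : ℝ} (hβ : 0 < β) (hν : 7 / 2 ≤ ν) (hσ : 0 < σ) : TL β ν σ := by
  obtain ⟨σ0, m, h0, h1, rfl⟩ := exists_frac hσ
  have : TL β ν (σ0 + m) ∧ TL β (ν + 1) (σ0 + m + 1) := by
    clear hσ
    induction m with
    | zero =>
      simp only [Nat.cast_zero, add_zero]
      exact ⟨TL_base hβ hν h0 (by linarith), TL_base hβ (by linarith) (by linarith) (by linarith)⟩
    | succ m ih =>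
      have := TL_step hβ (by linarith) (by positivity) ih.1 ih.2
      push_cast
      rw [← add_assoc]
      refine ⟨this.1, ?_⟩
      rw [show σ0 + (m : ℝ) + 1 + 1 = σ0 + m + 2 by ring]
      exact this.2
  exact this.1

lemma LL_raise {β ν σ : ℝ} (hβ : 0 < β) (hσ : 0 < σ) :
    LL β ν σ = (ν + 1) * LL β (ν + 1) σ - β ^ 2 * LL β (ν + 2) (σ + 2) := by
  unfold LL
  rw [inv_Gamma_rec (ν + 1 - σ / 2), show (σ + 2) / 2 = σ / 2 + 1 by ring, Real.Gamma_add_one (by positivity : σ / 2 ≠ 0),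
    show ν + 1 - σ / 2 + 1 = ν + 2 - σ / 2 by ring, show ν + 1 + 1 - σ / 2 = ν + 2 - σ / 2 by ring,
    show ν + 2 + 1 - (σ / 2 + 1) = ν + 2 - σ / 2 by ring, show -(σ + 2) = -σ - 2 by ring, Real.rpow_sub hβ]
  norm_cast
  field_simp

lemma TL_raise {β ν σ : ℝ} (hβ : 0 < β) (hν : -1 < ν) (hσ : 0 < σ)
    (h1 : TL β (ν + 1) σ) (h2 : TL β (ν + 2) (σ + 2)) : TL β ν σ := by
  have h := (h1.const_mul ((ν : ℂ) + 1)).sub (h2.const_mul ((β : ℂ) ^ 2))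
  unfold TL
  rw [LL_raise hβ hσ]
  push_cast at h ⊢
  refine h.congr' ?_
  filter_upwards [self_mem_nhdsWithin] with ε hε
  have hre : 0 < (ε : ℂ).re := by simpa using hε
  rw [LA_raise hν β hσ hre]

lemma TL_all {β ν σ : ℝ} (hβ : 0 < β) (hν : -1 < ν) (hσ : 0 < σ) : TL β ν σ := by
  have key : ∀ k : ℕ, ∀ ν σ : ℝ, -1 < ν → 0 < σ → 7 / 2 - (k : ℝ) ≤ ν → TL β ν σ := by
    intro k
    induction k with
    | zero => intro ν σ _ hσ h; exact TL_large hβ (by simpa using h) hσ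
    | succ k ih =>
      intro ν σ hν hσ h
      push_cast at h
      exact TL_raise hβ hν hσ (ih _ _ (by linarith) hσ (by linarith))
        (ih _ _ (by linarith) (by linarith) (by linarith))
  exact key 5 ν σ hν hσ (by push_cast; linarith)

lemma summable_rp {x K μ : ℝ} (hx : 0 < x) (hx4 : 4 * x < 1) (hK : 0 < K) (hμ : -1 < μ) :
    Summable fun r : ℕ => x ^ r / ((Nat.factorial r : ℝ) * Real.Gamma (μ + (r : ℝ) + 1)) * rp K (2 * r) := by
  refine summable_of_ratio_test_tendsto_lt_one (l := 4 * x) hx4 ?_ ?_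
  · refine Eventually.of_forall fun r => ?_
    have := Gpos hμ r
    have := rp_pos hK (2 * r)
    positivity
  · have h1 : ∀ r : ℕ, ‖x ^ (r + 1) / ((Nat.factorial (r + 1) : ℝ) * Real.Gamma (μ + ((r + 1 : ℕ) : ℝ) + 1)) * rp K (2 * (r + 1))‖ /
        ‖x ^ r / ((Nat.factorial r : ℝ) * Real.Gamma (μ + (r : ℝ) + 1)) * rp K (2 * r)‖
        = x * (2 + (K - 2) * (1 / ((r : ℝ) + 1))) * (2 + (K - 2 * μ - 1) * (μ + r + 1)⁻¹) := by
      intro r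
      have hg := Gpos hμ r
      have hg' := Gpos hμ (r + 1)
      have hr := rp_pos hK (2 * r)
      have hr' := rp_pos hK (2 * (r + 1))
      rw [Real.norm_of_nonneg (by positivity), Real.norm_of_nonneg (by positivity)]
      have h0 : (0:ℝ) < μ + r + 1 := by have : (0:ℝ) ≤ r := r.cast_nonneg; linarith
      have e : μ + ((r + 1 : ℕ) : ℝ) + 1 = (μ + r + 1) + 1 := by push_cast; ring
      rw [e, Real.Gamma_add_one h0.ne', Nat.factorial_succ, show 2 * (r + 1) = 2 * r + 1 + 1 by ring,
        rp_succ, rp_succ]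
      push_cast
      field_simp
      ring
    simp_rw [h1]
    have h2 : Tendsto (fun r : ℕ => (μ + (r : ℝ) + 1)⁻¹) atTop (𝓝 0) := by
      refine tendsto_inv_atTop_zero.comp ?_
      exact tendsto_atTop_add_const_right _ _ (tendsto_atTop_add_const_left _ _ tendsto_natCast_atTop_atTop)
    have h3 := ((tendsto_one_div_add_atTop_nhds_zero_nat (𝕜 := ℝ)).const_mul (K - 2)).const_add 2
    have h4 := (h2.const_mul (K - 2 * μ - 1)).const_add 2
    have := (h3.const_mul x).mul h4
    convert this using 2
    ring

/-- Coefficients of the expansion of the first Bessel factor. -/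
noncomputable def cc (α μ : ℝ) (r : ℕ) : ℝ :=
  (-α ^ 2) ^ r / ((Nat.factorial r : ℝ) * Real.Gamma (μ + (r : ℝ) + 1))

lemma abs_cc {α μ : ℝ} (hμ : -1 < μ) (r : ℕ) :
    |cc α μ r| = (α ^ 2) ^ r / ((Nat.factorial r : ℝ) * Real.Gamma (μ + (r : ℝ) + 1)) := by
  have := Gpos hμ r
  unfold cc
  rw [abs_div, abs_pow, abs_neg, abs_of_nonneg (sq_nonneg α), abs_of_pos (by positivity)]

noncomputable def GG (α β μ ν σ : ℝ) (p : ℂ) : ℂ :=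
  lap (fun t => t ^ (σ - 1) * (bf μ (α ^ 2 * t ^ 2) * bf ν (β ^ 2 * t ^ 2))) p

lemma lap_abs_bound {ν : ℝ} (hν : -1 < ν) (β : ℝ) : ∃ C, 0 ≤ C ∧ ∀ σ c : ℝ, 0 < σ → 0 < c →
    ∫ t in Ioi (0:ℝ), Real.exp (-c * t) * |t ^ (σ - 1) * bf ν (β ^ 2 * t ^ 2)| ≤
      C * ((1 / c) ^ σ * Real.Gamma σ + (1 / c) ^ (σ + 2) * Real.Gamma (σ + 2)) := by
  obtain ⟨C, hC, h⟩ := bf_growth' hν β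
  refine ⟨C, hC, fun σ c hσ hc => ?_⟩
  have i1 := integrableOn_rpow_mul_exp_neg_mul_rpow (p := 1) (s := σ - 1) (b := c) (by linarith) one_pos hc
  have i2 := integrableOn_rpow_mul_exp_neg_mul_rpow (p := 1) (s := σ + 2 - 1) (b := c) (by linarith) one_pos hc
  have e1 := Real.integral_rpow_mul_exp_neg_mul_Ioi hσ hc
  have e2 := Real.integral_rpow_mul_exp_neg_mul_Ioi (by linarith : 0 < σ + 2) hc
  simp only [Real.rpow_one, neg_mul] at i1 i2
  rw [← e1, ← e2, ← integral_add i1 i2, ← integral_const_mul]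
  refine setIntegral_mono_on ((LI_bf hν β hσ).abs_int hc) ((i1.add i2).const_mul C) measurableSet_Ioi ?_
  intro t ht
  have ht : 0 < t := ht
  rw [abs_mul, abs_of_pos (by positivity : 0 < t ^ (σ - 1)), show σ + 2 - 1 = σ - 1 + 2 by ring,
    Real.rpow_add ht, neg_mul]
  norm_cast
  calc _ ≤ Real.exp (-(c * t)) * (t ^ (σ - 1) * (C * (1 + t ^ 2))) := by gcongr; exact h t
    _ = _ := by ring

lemma GG_eq_large {α β μ ν σ : ℝ} (hα : 0 < α) (hμ : -1 < μ) (hν : -1 < ν) (hσ : 0 < σ) {p : ℂ}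
    (hp : 2 * α < p.re) :
    GG α β μ ν σ p = ∑' r : ℕ, (cc α μ r : ℂ) * LA β ν (σ + (2 * r : ℕ)) p := by
  have hc : 0 < p.re := by linarith
  set c := p.re with hcdef
  obtain ⟨C, hC, hb⟩ := lap_abs_bound hν β
  have hpos : ∀ r : ℕ, 0 < σ + ((2 * r : ℕ) : ℝ) := fun r => by positivity
  set F : ℕ → ℝ → ℂ := fun r t =>
    (cc α μ r : ℂ) * (Complex.exp (-p * t) * ((t ^ (σ + ((2 * r : ℕ) : ℝ) - 1) * bf ν (β ^ 2 * t ^ 2) : ℝ) : ℂ)) with hF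
  have hintg : ∀ r, Integrable (F r) (volume.restrict (Ioi 0)) := fun r =>
    Integrable.const_mul ((LI_bf hν β (hpos r)).int hc) _
  set x := α ^ 2 / c ^ 2 with hx
  have hx0 : 0 < x := by positivity
  have hx4 : 4 * x < 1 := by
    rw [hx, ← mul_div_assoc, div_lt_one (by positivity)]
    nlinarith
  have hsum : Summable fun r => ∫ t in Ioi (0:ℝ), ‖F r t‖ := by
    refine Summable.of_nonneg_of_le (fun r => integral_nonneg fun t => norm_nonneg _) (fun r => ?_)
      (((summable_rp hx0 hx4 hσ hμ).mul_left (C * (1 / c) ^ σ * Real.Gamma σ)).add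
        ((summable_rp hx0 hx4 (by linarith : 0 < σ + 2) hμ).mul_left (C * (1 / c) ^ (σ + 2) * Real.Gamma (σ + 2))))
    have e : ∫ t in Ioi (0:ℝ), ‖F r t‖ = |cc α μ r| *
        ∫ t in Ioi (0:ℝ), Real.exp (-c * t) * |t ^ (σ + ((2 * r : ℕ) : ℝ) - 1) * bf ν (β ^ 2 * t ^ 2)| := by
      rw [← integral_const_mul]
      congr 1; ext t
      simp only [hF]
      rw [norm_mul, norm_cexp_mul, Complex.norm_real, Real.norm_eq_abs]
    rw [e]
    refine (mul_le_mul_of_nonneg_left (hb _ c (hpos r) hc) (abs_nonneg _)).trans (le_of_eq ?_)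
    rw [abs_cc hμ, show σ + ((2 * r : ℕ) : ℝ) + 2 = (σ + 2) + ((2 * r : ℕ) : ℝ) by ring,
      Gamma_rp hσ, Gamma_rp (by linarith : 0 < σ + 2), Real.rpow_add_natCast (by positivity),
      Real.rpow_add_natCast (by positivity), hx, div_pow, div_pow, one_pow, pow_mul c]
    ring
  have key := hasSum_integral_of_summable_integral_norm hintg hsum
  have e2 : ∀ r, ∫ t in Ioi (0:ℝ), F r t = (cc α μ r : ℂ) * LA β ν (σ + (2 * r : ℕ)) p := by
    intro r
    simp only [hF]
    rw [integral_const_mul]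
    rfl
  simp_rw [e2] at key
  rw [key.tsum_eq, GG, lap]
  refine setIntegral_congr_fun measurableSet_Ioi fun t ht => ?_
  have ht : 0 < t := ht
  simp only [hF]
  have h3 : t ^ (σ - 1) * (bf μ (α ^ 2 * t ^ 2) * bf ν (β ^ 2 * t ^ 2)) =
      ∑' r : ℕ, cc α μ r * (t ^ (σ + ((2 * r : ℕ) : ℝ) - 1) * bf ν (β ^ 2 * t ^ 2)) := by
    rw [bf, ← tsum_mul_right, ← tsum_mul_left]
    refine tsum_congr fun r => ?_
    rw [show σ + ((2 * r : ℕ) : ℝ) - 1 = σ - 1 + ((2 * r : ℕ) : ℝ) by ring, Real.rpow_add_natCast ht.ne', cc,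
      show -(α ^ 2 * t ^ 2) = -α ^ 2 * t ^ 2 by ring, mul_pow, ← pow_mul]
    ring
  rw [h3, Complex.ofReal_tsum, ← tsum_mul_left]
  refine tsum_congr fun r => ?_
  push_cast
  ring

lemma GG_bound {α β μ ν σ ρ : ℝ} (hα : 0 < α) (hβ : 0 < β) (hμ : -1 < μ) (hν : -1 < ν) (hσ : 0 < σ)
    (hρ : 2 * α < ρ) : ∃ u : ℕ → ℝ, Summable u ∧
      ∀ r p, p ∈ Om β ρ → ‖(cc α μ r : ℂ) * LA β ν (σ + (2 * r : ℕ)) p‖ ≤ u r := by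
  have hρ0 : 0 < ρ := by linarith
  obtain ⟨C, K, hC, hK, h⟩ := SB_all hβ hρ0 hν hσ
  set x := α ^ 2 / ρ ^ 2 with hx
  have hx0 : 0 < x := by positivity
  have hx4 : 4 * x < 1 := by
    rw [hx, ← mul_div_assoc, div_lt_one (by positivity)]
    nlinarith
  refine ⟨_, (summable_rp hx0 hx4 hK hμ).mul_left C, fun r p hp => ?_⟩
  rw [norm_mul, Complex.norm_real, Real.norm_eq_abs]
  refine (mul_le_mul_of_nonneg_left (h (2 * r) p hp) (abs_nonneg _)).trans (le_of_eq ?_)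
  have := Gpos hμ r
  rw [abs_cc hμ, hx, div_pow, pow_mul ρ]
  field_simp

lemma strip_sub {β ρ : ℝ} {p : ℂ} (h0 : 0 < p.re) (h1 : |p.im| < 2 * β - ρ) : p ∈ Om β ρ := by
  have h2 := abs_lt.1 h1
  refine ⟨h0, ?_, ?_⟩
  · refine le_trans ?_ (Complex.abs_im_le_norm _)
    refine le_trans ?_ (neg_le_abs _)
    simp
    linarith
  · refine le_trans ?_ (Complex.abs_im_le_norm _)
    refine le_trans ?_ (le_abs_self _)
    simp
    linarith

lemma GG_eq {α β μ ν σ : ℝ} (hα : 0 < α) (hαβ : α < β) (hμ : -1 < μ) (hν : -1 < ν) (hσ : 0 < σ)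
    {ε : ℝ} (hε : 0 < ε) :
    GG α β μ ν σ ε = ∑' r : ℕ, (cc α μ r : ℂ) * LA β ν (σ + (2 * r : ℕ)) ε := by
  obtain ⟨u, hu, hb⟩ := GG_bound hα (by linarith : 0 < β) hμ hν hσ (by linarith : 2 * α < α + β)
  set U : Set ℂ := Complex.re ⁻¹' Ioi 0 ∩ Complex.im ⁻¹' Ioo (-(β - α)) (β - α) with hU
  have hUo : IsOpen U := (isOpen_Ioi.preimage Complex.continuous_re).inter (isOpen_Ioo.preimage Complex.continuous_im)
  have hUc : IsPreconnected U :=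
    (((convex_Ioi (0:ℝ)).linear_preimage Complex.reLm).inter
      ((convex_Ioo (-(β - α)) (β - α)).linear_preimage Complex.imLm)).isPreconnected
  have hUOm : ∀ p ∈ U, p ∈ Om β (α + β) := fun p hp => by
    refine strip_sub hp.1 ?_
    have := abs_lt.2 hp.2
    linarith
  have hS : DifferentiableOn ℂ (fun p => ∑' r : ℕ, (cc α μ r : ℂ) * LA β ν (σ + (2 * r : ℕ)) p) U := by
    refine Complex.differentiableOn_tsum_of_summable_norm hu (fun r => ?_) hUo (fun r p hp => hb r p (hUOm p hp))
    intro p hp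
    exact (((LI_bf hν β (by positivity : 0 < σ + ((2 * r : ℕ) : ℝ))).diff hp.1).const_mul _).differentiableWithinAt
  have hG : DifferentiableOn ℂ (GG α β μ ν σ) U := fun p hp =>
    (((GB_bf_bf hμ hν α β).li hσ).diff hp.1).differentiableWithinAt
  have key := (hG.analyticOnNhd hUo).eqOn_of_preconnected_of_eventuallyEq (hS.analyticOnNhd hUo) hUc
    (z₀ := ((2 * α + 1 : ℝ) : ℂ)) ?_ ?_
  · refine key ?_
    simp [hU, hε, hαβ]
  · simp [hU, hαβ]
    positivity
  · have hs : {z : ℂ | 2 * α < z.re} ∈ 𝓝 ((2 * α + 1 : ℝ) : ℂ) := by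
      refine (isOpen_lt continuous_const Complex.continuous_re).mem_nhds ?_
      simp
    filter_upwards [hs] with p hp
    exact GG_eq_large hα hμ hν hσ hp

lemma GG_tendsto {α β μ ν σ : ℝ} (hα : 0 < α) (hαβ : α < β) (hμ : -1 < μ) (hν : -1 < ν) (hσ : 0 < σ) :
    Tendsto (fun ε : ℝ => GG α β μ ν σ ε) (𝓝[>] 0)
      (𝓝 ((∑' r : ℕ, cc α μ r * LL β ν (σ + (2 * r : ℕ)) : ℝ) : ℂ)) := by
  obtain ⟨u, hu, hb⟩ := GG_bound hα (by linarith : 0 < β) hμ hν hσ (by linarith : 2 * α < α + β)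
  have key := tendsto_tsum_of_dominated_convergence (𝓕 := 𝓝[>] (0:ℝ)) hu
    (f := fun (ε : ℝ) (r : ℕ) => (cc α μ r : ℂ) * LA β ν (σ + (2 * r : ℕ)) ε)
    (g := fun r : ℕ => (cc α μ r : ℂ) * ((LL β ν (σ + (2 * r : ℕ)) : ℝ) : ℂ))
    (fun r => (TL_all (by linarith : 0 < β) hν (by positivity : 0 < σ + ((2 * r : ℕ) : ℝ))).const_mul _) ?_
  · rw [Complex.ofReal_tsum]
    simp_rw [Complex.ofReal_mul]
    refine key.congr' ?_
    filter_upwards [self_mem_nhdsWithin] with ε hε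
    exact (GG_eq hα hαβ hμ hν hσ hε).symm
  · filter_upwards [self_mem_nhdsWithin] with ε hε r
    refine hb r _ (strip_sub (by simpa using hε) ?_)
    simpa using (by linarith : α + β < 2 * β)

lemma GG_real {α β μ ν σ ε : ℝ} : GG α β μ ν σ ε =
    ((∫ t in Ioi (0:ℝ), Real.exp (-ε * t) * (t ^ (σ - 1) * (bf μ (α ^ 2 * t ^ 2) * bf ν (β ^ 2 * t ^ 2))) : ℝ) : ℂ) := by
  rw [← integral_complex_ofReal, GG, lap]
  congr 1; ext t
  push_cast
  rfl

lemma besselJ_eq {ν β t : ℝ} (hβ : 0 < β) (ht : 0 < t) :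
    besselJ ν (2 * β * t) = β ^ ν * t ^ ν * bf ν (β ^ 2 * t ^ 2) := by
  unfold besselJ bf
  rw [← tsum_mul_left]
  refine tsum_congr fun r => ?_
  have hx : 0 < 2 * β * t := by positivity
  have e : ν + 2 * (r : ℝ) = ν + ((2 * r : ℕ) : ℝ) := by push_cast; ring
  rw [e, Real.rpow_add_natCast hx.ne', Real.rpow_add_natCast two_ne_zero, mul_assoc 2 β t,
    Real.mul_rpow zero_le_two (by positivity), Real.mul_rpow hβ.le ht.le, ← mul_pow β t 2, neg_pow ((β * t) ^ 2), mul_pow 2 (β * t),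
    pow_mul (β * t)]
  rw [mul_assoc ((2:ℝ) ^ ν * 2 ^ (2 * r)), ← div_div]
  have : (2:ℝ) ^ ν ≠ 0 := by positivity
  rw [mul_div_assoc', mul_comm (Nat.factorial r : ℝ)]
  congr 1
  field_simp

lemma limit_eq {a b lam μ ν : ℝ} (ha : 0 < a) (hb : 0 < b) (hlam : lam < μ + ν + 1) (hμ : -1 < μ) :
    (a / 2) ^ μ * (b / 2) ^ ν * ∑' r : ℕ, cc (a / 2) μ r * LL (b / 2) ν (μ + ν - lam + 1 + (2 * r : ℕ)) =
    a ^ μ * Real.Gamma ((μ + ν - lam + 1) / 2) /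
          (2 ^ lam * b ^ (μ - lam + 1) * Real.Gamma (μ + 1) *
            Real.Gamma ((lam + ν - μ + 1) / 2)) *
        hyperF ((μ + ν - lam + 1) / 2) ((μ - lam - ν + 1) / 2) (μ + 1) (a ^ 2 / b ^ 2) := by
  unfold hyperF
  rw [← tsum_mul_left, ← tsum_mul_left]
  refine tsum_congr fun r => ?_
  rw [rp_eq_asc, rp_eq_asc, rp_eq_asc]
  unfold cc LL
  set s := (μ + ν - lam + 1) / 2 with hs
  have hs0 : 0 < s := by rw [hs]; linarith
  have hm : 0 < μ + 1 := by linarith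
  rw [show (μ + ν - lam + 1 + ((2 * r : ℕ) : ℝ)) / 2 = s + r by rw [hs]; push_cast; ring,
    show ν + 1 - (s + r) = (lam + ν - μ + 1) / 2 - r by rw [hs]; ring, inv_Gamma_sub,
    show 1 - (lam + ν - μ + 1) / 2 = (μ - lam - ν + 1) / 2 by ring, Gamma_rp hs0,
    show μ + (r : ℝ) + 1 = μ + 1 + r by ring, Gamma_rp hm,
    show -(μ + ν - lam + 1 + ((2 * r : ℕ) : ℝ)) = -(μ + ν - lam + 1) - ((2 * r : ℕ) : ℝ) by ring,
    Real.rpow_sub_natCast (by positivity)]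
  have e : (a / 2) ^ μ * (b / 2) ^ ν * ((b / 2) ^ (-(μ + ν - lam + 1))) / 2 = a ^ μ / (2 ^ lam * b ^ (μ - lam + 1)) := by
    rw [mul_assoc, ← Real.rpow_add (by positivity), Real.div_rpow ha.le zero_le_two,
      show ν + -(μ + ν - lam + 1) = -(μ - lam + 1) by ring, Real.rpow_neg (by positivity),
      Real.div_rpow hb.le zero_le_two, show lam = μ - (μ - lam + 1) + 1 by ring, Real.rpow_add zero_lt_two,
      Real.rpow_sub zero_lt_two, show μ - (μ - (μ - lam + 1) + 1) + 1 = μ - lam + 1 by ring, Real.rpow_one]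
    field_simp
  rw [div_mul_eq_mul_div _ (2 ^ lam * b ^ (μ - lam + 1) * Real.Gamma (μ + 1) * Real.Gamma ((lam + ν - μ + 1) / 2))]
  have h1 : (-(a / 2) ^ 2) ^ r * ((b / 2) ^ (2 * r))⁻¹ * (-1) ^ r = (a ^ 2 / b ^ 2) ^ r := by
    rw [pow_mul, ← inv_pow, ← mul_pow, ← mul_pow]
    congr 1
    field_simp
  calc _ = ((a / 2) ^ μ * (b / 2) ^ ν * ((b / 2) ^ (-(μ + ν - lam + 1))) / 2) *
        ((-(a / 2) ^ 2) ^ r * ((b / 2) ^ (2 * r))⁻¹ * (-1) ^ r) *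
        (Real.Gamma s * rp s r * rp ((μ - lam - ν + 1) / 2) r * (Real.Gamma ((lam + ν - μ + 1) / 2))⁻¹ *
        ((Nat.factorial r : ℝ) * (Real.Gamma (μ + 1) * rp (μ + 1) r))⁻¹) := by
        simp only [div_eq_mul_inv]; ring
    _ = _ := by
      rw [e, h1]
      simp only [div_eq_mul_inv, mul_inv]; ring

/-- Weber–Schafheitlin type limit, case `0 < a < b`:
`lim_{ε→0+} ∫_0^∞ e^{-εt} t^{-λ} J_μ(at) J_ν(bt) dt` equals the stated
hypergeometric expression. -/
theorem tendsto_weberSchafheitlin_of_gt (a b lam μ ν : ℝ) (ha : 0 < a) (hab : a < b)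
    (hlam : μ + ν + 1 > lam) (hμ : μ > -1) (hν : ν > -1)
    (hΓ : ∀ k : ℕ, (lam + ν - μ + 1) / 2 ≠ -(k : ℝ)) :
    Filter.Tendsto
      (fun ε : ℝ => ∫ t in Set.Ioi (0 : ℝ),
        Real.exp (-ε * t) * t ^ (-lam) * besselJ μ (a * t) * besselJ ν (b * t))
      (nhdsWithin 0 (Set.Ioi 0))
      (nhds (a ^ μ * Real.Gamma ((μ + ν - lam + 1) / 2) /
          (2 ^ lam * b ^ (μ - lam + 1) * Real.Gamma (μ + 1) *
            Real.Gamma ((lam + ν - μ + 1) / 2)) *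
        hyperF ((μ + ν - lam + 1) / 2) ((μ - lam - ν + 1) / 2) (μ + 1) (a ^ 2 / b ^ 2))) := by
  have hb : 0 < b := ha.trans hab
  have hσ : 0 < μ + ν - lam + 1 := by linarith
  have h1 := GG_tendsto (by positivity : 0 < a / 2) (by linarith : a / 2 < b / 2) hμ hν hσ
  have h2 := (Complex.continuous_re.tendsto _).comp h1
  rw [Complex.ofReal_re] at h2
  have h3 := h2.const_mul ((a / 2) ^ μ * (b / 2) ^ ν)
  rw [limit_eq ha hb (by linarith) hμ] at h3
  refine h3.congr fun ε => ?_
  simp only [Function.comp_apply]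
  rw [GG_real, Complex.ofReal_re, ← integral_const_mul]
  refine setIntegral_congr_fun measurableSet_Ioi fun t ht => ?_
  have ht : 0 < t := ht
  have e1 := besselJ_eq (ν := μ) (by positivity : 0 < a / 2) ht
  have e2 := besselJ_eq (ν := ν) (by positivity : 0 < b / 2) ht
  rw [mul_div_cancel₀ a two_ne_zero] at e1
  rw [mul_div_cancel₀ b two_ne_zero] at e2
  rw [e1, e2, show μ + ν - lam + 1 - 1 = -lam + μ + ν by ring, Real.rpow_add ht, Real.rpow_add ht]
  ring
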